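/- arXiv:2310.15756 — 3 statements merged into one kernel-verified Lean document; each statement's English description precedes it below -/
import Mathlib

section
/- Let C_G(E) denote the capacity of the average-intensity-constrained Gaussian optical intensity channel. Then limsup_{E → 0⁺} C_G(E) / (E · √(log(1/E))) ≤ 1/√2. -/
open MeasureTheory ProbabilityTheory Filter
open scoped Classical

/-- Kullback–Leibler divergence (natural logarithm), with value `⊤` when it is
not defined as a real number. -/
noncomputable def klDiv {α : Type*} [MeasurableSpace α] (μ ν : Measure α) : EReal :=
  if μ ≪ ν ∧ Integrable (fun x => Real.log (μ.rnDeriv ν x).toReal) μ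
  then ((∫ x, Real.log (μ.rnDeriv ν x).toReal ∂μ : ℝ) : EReal)
  else ⊤

/-- Mutual information between the input `X ~ μ` and the output `Y = X + Z` of the
Gaussian optical intensity channel, where `Z ~ N(0,1)` is independent of `X`:
the KL divergence between the joint law of `(X, X + Z)` and the product of its
two marginals. -/
noncomputable def gaussianMI (μ : Measure ℝ) : EReal :=
  let joint : Measure (ℝ × ℝ) :=
    (μ.prod (gaussianReal 0 1)).map (fun p => (p.1, p.1 + p.2))
  klDiv joint (joint.fst.prod joint.snd)

/-- Capacity of the average-intensity-constrained Gaussian optical intensity channel: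
the supremum of the mutual information over all probability measures on `ℝ`
concentrated on `[0, ∞)` with mean at most `E`. -/
noncomputable def C_G (E : ℝ) : EReal :=
  ⨆ (μ : Measure ℝ) (_ : IsProbabilityMeasure μ) (_ : μ (Set.Iio 0) = 0)
    (_ : ∫⁻ x, ENNReal.ofReal x ∂μ ≤ ENNReal.ofReal E), gaussianMI μ

lemma integral_exp_neg_abs : ∫ x : ℝ, Real.exp (-|x|) = 2 := by
  rw [integral_comp_abs (f := fun x => Real.exp (-x)), integral_exp_neg_Ioi]
  simp

lemma integrable_exp_neg_abs : Integrable (fun x : ℝ => Real.exp (-|x|)) :=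
  Integrable.of_integral_ne_zero (by rw [integral_exp_neg_abs]; norm_num)

/-- The output density of the Gaussian channel with input law `μ`. -/
noncomputable def outputDensity (μ : Measure ℝ) (y : ℝ) : ENNReal :=
  ∫⁻ x, gaussianPDF x 1 y ∂μ

lemma measurable_gaussianPDF_uncurry :
    Measurable (fun p : ℝ × ℝ => gaussianPDF p.1 1 p.2) := by
  unfold gaussianPDF gaussianPDFReal
  fun_prop

lemma measurable_gaussianPDF_mean (y : ℝ) : Measurable (fun x => gaussianPDF x 1 y) := by
  unfold gaussianPDF gaussianPDFReal
  fun_prop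

lemma measurable_outputDensity (μ : Measure ℝ) [SFinite μ] : Measurable (outputDensity μ) :=
  measurable_gaussianPDF_uncurry.lintegral_prod_left'

lemma gaussianPDFReal_one_le_one (x y : ℝ) : gaussianPDFReal x 1 y ≤ 1 := by
  unfold gaussianPDFReal
  have h : 1 ≤ √(2 * Real.pi * (1 : NNReal)) := by
    rw [Real.one_le_sqrt]
    have := Real.pi_gt_three
    norm_num
    linarith
  refine mul_le_one₀ (inv_le_one_of_one_le₀ h) (Real.exp_nonneg _) (Real.exp_le_one_iff.2 ?_)
  have := sq_nonneg (y - x)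
  norm_num
  linarith

lemma outputDensity_ne_top (μ : Measure ℝ) [IsProbabilityMeasure μ] (y : ℝ) :
    outputDensity μ y ≠ ⊤ := by
  have : outputDensity μ y ≤ ∫⁻ _, 1 ∂μ := by
    refine lintegral_mono fun x => ?_
    exact ENNReal.ofReal_le_one.2 (gaussianPDFReal_one_le_one x y)
  rw [lintegral_one, measure_univ] at this
  exact (this.trans_lt ENNReal.one_lt_top).ne

lemma outputDensity_ne_zero (μ : Measure ℝ) [IsProbabilityMeasure μ] (y : ℝ) :
    outputDensity μ y ≠ 0 := by
  refine ((lintegral_pos_iff_support (measurable_gaussianPDF_mean y)).2 ?_).ne'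
  have : (Function.support fun x => gaussianPDF x 1 y) = Set.univ := by
    ext x
    simpa using (gaussianPDF_pos x one_ne_zero y).ne'
  simp [this]

/-- The joint law of input and output of the Gaussian channel. -/
noncomputable def jointLaw (μ : Measure ℝ) : Measure (ℝ × ℝ) :=
  (μ.prod (gaussianReal 0 1)).map (fun p => (p.1, p.1 + p.2))

lemma measurable_channel : Measurable (fun p : ℝ × ℝ => (p.1, p.1 + p.2)) := by
  fun_prop

lemma jointLaw_eq_withDensity (μ : Measure ℝ) [IsProbabilityMeasure μ] :
    jointLaw μ = (μ.prod volume).withDensity (fun p => gaussianPDF p.1 1 p.2) := by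
  refine Measure.ext_of_lintegral _ fun f hf => ?_
  have hfc : Measurable fun p : ℝ × ℝ => f (p.1, p.1 + p.2) := hf.comp measurable_channel
  rw [jointLaw, lintegral_map hf measurable_channel, lintegral_prod _ hfc.aemeasurable,
    lintegral_withDensity_eq_lintegral_mul _ measurable_gaussianPDF_uncurry hf,
    lintegral_prod _ (measurable_gaussianPDF_uncurry.mul hf).aemeasurable]
  refine lintegral_congr fun x => ?_
  have hfx : Measurable fun y => f (x, y) := hf.comp measurable_prodMk_left
  have h := gaussianReal_map_const_add (μ := 0) (v := 1) x
  rw [zero_add, gaussianReal_of_var_ne_zero x one_ne_zero] at h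
  rw [← lintegral_map (f := fun y => f (x, y)) hfx (measurable_const_add x), h,
    lintegral_withDensity_eq_lintegral_mul _ (measurable_gaussianPDF x 1) hfx]
  rfl

lemma jointLaw_fst (μ : Measure ℝ) [IsProbabilityMeasure μ] : (jointLaw μ).fst = μ := by
  rw [jointLaw, Measure.fst, Measure.map_map measurable_fst measurable_channel]
  exact Measure.fst_prod

lemma jointLaw_snd (μ : Measure ℝ) [IsProbabilityMeasure μ] :
    (jointLaw μ).snd = volume.withDensity (outputDensity μ) := by
  refine Measure.ext_of_lintegral _ fun f hf => ?_
  have hf2 : Measurable fun p : ℝ × ℝ => f p.2 := hf.comp measurable_snd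
  rw [Measure.snd, lintegral_map hf measurable_snd, jointLaw_eq_withDensity,
    lintegral_withDensity_eq_lintegral_mul _ measurable_gaussianPDF_uncurry hf2,
    lintegral_prod_symm _ (measurable_gaussianPDF_uncurry.mul hf2).aemeasurable,
    lintegral_withDensity_eq_lintegral_mul _ (measurable_outputDensity μ) hf]
  refine lintegral_congr fun y => ?_
  simp only [Pi.mul_apply, outputDensity]
  exact lintegral_mul_const _ (measurable_gaussianPDF_mean y)

lemma jointLaw_eq_withDensity_prod (μ : Measure ℝ) [IsProbabilityMeasure μ] :
    jointLaw μ = ((jointLaw μ).fst.prod (jointLaw μ).snd).withDensity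
      (fun p => gaussianPDF p.1 1 p.2 / outputDensity μ p.2) := by
  have hp : Measurable fun p : ℝ × ℝ => outputDensity μ p.2 :=
    (measurable_outputDensity μ).comp measurable_snd
  have hm : Measurable fun p : ℝ × ℝ => gaussianPDF p.1 1 p.2 / outputDensity μ p.2 :=
    measurable_gaussianPDF_uncurry.div hp
  have hmul : (fun p : ℝ × ℝ => gaussianPDF p.1 1 p.2) = (fun p => outputDensity μ p.2) *
      fun p => gaussianPDF p.1 1 p.2 / outputDensity μ p.2 := by
    funext p
    rw [Pi.mul_apply, ENNReal.mul_div_cancel (outputDensity_ne_zero μ p.2)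
      (outputDensity_ne_top μ p.2)]
  rw [jointLaw_fst, jointLaw_snd, prod_withDensity_right (measurable_outputDensity μ),
    jointLaw_eq_withDensity, hmul]
  exact withDensity_mul _ hp hm

instance (μ : Measure ℝ) [IsProbabilityMeasure μ] : IsProbabilityMeasure (jointLaw μ) :=
  Measure.isProbabilityMeasure_map measurable_channel.aemeasurable

lemma ae_log_rnDeriv_jointLaw (μ : Measure ℝ) [IsProbabilityMeasure μ] :
    (fun p => Real.log ((jointLaw μ).rnDeriv
        ((jointLaw μ).fst.prod (jointLaw μ).snd) p).toReal) =ᵐ[jointLaw μ]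
      fun p => Real.log (gaussianPDFReal p.1 1 p.2)
        - Real.log (outputDensity μ p.2).toReal := by
  have hm : Measurable fun p : ℝ × ℝ => gaussianPDF p.1 1 p.2 / outputDensity μ p.2 :=
    measurable_gaussianPDF_uncurry.div ((measurable_outputDensity μ).comp measurable_snd)
  have h := Measure.rnDeriv_withDensity ((jointLaw μ).fst.prod (jointLaw μ).snd) hm
  rw [← jointLaw_eq_withDensity_prod] at h
  have hac : jointLaw μ ≪ (jointLaw μ).fst.prod (jointLaw μ).snd := by
    conv_lhs => rw [jointLaw_eq_withDensity_prod]
    exact withDensity_absolutelyContinuous _ _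
  filter_upwards [hac.ae_le h] with p hp
  rw [hp, ENNReal.toReal_div, gaussianPDF, ENNReal.toReal_ofReal (gaussianPDFReal_nonneg _ _ _),
    Real.log_div (gaussianPDFReal_pos _ _ _ one_ne_zero).ne'
      (ENNReal.toReal_pos (outputDensity_ne_zero μ _) (outputDensity_ne_top μ _)).ne']

lemma integral_div_outputDensity (μ : Measure ℝ) [IsProbabilityMeasure μ] {q : ℝ → ℝ}
    (hqi : Integrable q) :
    Integrable (fun y => q y / (outputDensity μ y).toReal) (jointLaw μ).snd ∧
      ∫ y, q y / (outputDensity μ y).toReal ∂(jointLaw μ).snd = ∫ y, q y := by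
  have hpos (y) := ENNReal.toReal_pos (outputDensity_ne_zero μ y) (outputDensity_ne_top μ y)
  have hlt : ∀ᵐ y : ℝ, outputDensity μ y < ⊤ :=
    ae_of_all _ fun y => (outputDensity_ne_top μ y).lt_top
  have heq : (fun y => (outputDensity μ y).toReal • (q y / (outputDensity μ y).toReal)) = q := by
    ext y
    rw [smul_eq_mul, mul_div_cancel₀ _ (hpos y).ne']
  rw [jointLaw_snd, integrable_withDensity_iff_integrable_smul' (measurable_outputDensity μ) hlt,
    integral_withDensity_eq_integral_toReal_smul (measurable_outputDensity μ) hlt, heq]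
  exact ⟨hqi, rfl⟩

/-- Duality bound: any output density `q` yields an upper bound on the mutual information. -/
lemma gaussianMI_le_of_density (μ : Measure ℝ) [IsProbabilityMeasure μ] {q : ℝ → ℝ}
    (hq0 : ∀ y, 0 < q y) (hqi : Integrable q) (hq1 : ∫ y, q y = 1)
    {B : ℝ × ℝ → ℝ} (hB : Integrable B (μ.prod (gaussianReal 0 1)))
    (hle : ∀ᵐ p ∂μ.prod (gaussianReal 0 1),
      Real.log (gaussianPDFReal p.1 1 (p.1 + p.2)) - Real.log (q (p.1 + p.2)) ≤ B p)
    (htop : gaussianMI μ ≠ ⊤) :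
    gaussianMI μ ≤ ((∫ p, B p ∂μ.prod (gaussianReal 0 1) : ℝ) : EReal) := by
  change klDiv (jointLaw μ) ((jointLaw μ).fst.prod (jointLaw μ).snd) ≠ ⊤ at htop
  change klDiv (jointLaw μ) ((jointLaw μ).fst.prod (jointLaw μ).snd) ≤ _
  unfold klDiv at htop ⊢
  split_ifs at htop ⊢ with hc
  · have hae := ae_log_rnDeriv_jointLaw μ
    have hint := (integrable_congr hae).1 hc.2
    rw [integral_congr_ae hae, EReal.coe_le_coe_iff]
    have hsm := hint.aestronglyMeasurable
    obtain ⟨hri, hr1⟩ := integral_div_outputDensity μ hqi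
    rw [Measure.snd] at hri hr1
    rw [integral_map measurable_snd.aemeasurable hri.aestronglyMeasurable] at hr1
    replace hri : Integrable (fun p => q p.2 / (outputDensity μ p.2).toReal) (jointLaw μ) :=
      hri.comp_measurable measurable_snd
    have hrm := hri.aestronglyMeasurable
    rw [jointLaw] at hint hsm hri hr1 hrm ⊢
    rw [integral_map measurable_channel.aemeasurable hrm] at hr1
    replace hri : Integrable
        (fun p => q (p.1 + p.2) / (outputDensity μ (p.1 + p.2)).toReal)
        (μ.prod (gaussianReal 0 1)) :=
      hri.comp_measurable measurable_channel
    replace hint := hint.comp_measurable measurable_channel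
    rw [integral_map measurable_channel.aemeasurable hsm]
    have hri1 : Integrable
        (fun p => q (p.1 + p.2) / (outputDensity μ (p.1 + p.2)).toReal - 1)
        (μ.prod (gaussianReal 0 1)) := hri.sub (integrable_const 1)
    calc _ ≤ ∫ p : ℝ × ℝ, (q (p.1 + p.2) / (outputDensity μ (p.1 + p.2)).toReal - 1) + B p
            ∂μ.prod (gaussianReal 0 1) := by
          refine integral_mono_ae hint (hri1.add hB) ?_
          filter_upwards [hle] with p hp
          have hpos := ENNReal.toReal_pos (outputDensity_ne_zero μ (p.1 + p.2))
            (outputDensity_ne_top μ (p.1 + p.2))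
          have h := Real.log_le_sub_one_of_pos (div_pos (hq0 (p.1 + p.2)) hpos)
          rw [Real.log_div (hq0 _).ne' hpos.ne'] at h
          linarith
      _ = ∫ p, B p ∂μ.prod (gaussianReal 0 1) := by
          rw [integral_add hri1 hB,
            integral_sub hri (integrable_const 1), hr1, hq1]
          simp
  · exact absurd rfl htop

/-- Mixture of the standard Gaussian and Laplace densities with weight `E` on the latter. -/
noncomputable def mixtureDensity (E y : ℝ) : ℝ :=
  (1 - E) * gaussianPDFReal 0 1 y + E / 2 * Real.exp (-|y|)

lemma integrable_mixtureDensity (E : ℝ) : Integrable (mixtureDensity E) :=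
  ((integrable_gaussianPDFReal 0 1).const_mul _).add (integrable_exp_neg_abs.const_mul _)

lemma integral_mixtureDensity (E : ℝ) : ∫ y, mixtureDensity E y = 1 := by
  unfold mixtureDensity
  rw [integral_add ((integrable_gaussianPDFReal 0 1).const_mul _)
    (integrable_exp_neg_abs.const_mul _), integral_const_mul, integral_const_mul,
    integral_gaussianPDFReal_eq_one 0 one_ne_zero, integral_exp_neg_abs]
  ring

lemma mixtureDensity_pos {E : ℝ} (h0 : 0 < E) (h1 : E < 1) (y : ℝ) : 0 < mixtureDensity E y :=
  add_pos (mul_pos (by linarith) (gaussianPDFReal_pos 0 1 y one_ne_zero))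
    (mul_pos (by linarith) (Real.exp_pos _))

lemma log_gaussianPDFReal_one (x y : ℝ) :
    Real.log (gaussianPDFReal x 1 y) =
      Real.log (√(2 * Real.pi * (1 : NNReal)))⁻¹ - (y - x) ^ 2 / 2 := by
  have : (√(2 * Real.pi * (1 : NNReal)))⁻¹ ≠ 0 := by
    have := Real.pi_pos
    norm_num
    positivity
  rw [gaussianPDFReal, Real.log_mul this (Real.exp_pos _).ne', Real.log_exp]
  norm_num
  ring

lemma log_gaussianPDFReal_sub_log_mixtureDensity_le {E t x z : ℝ} (h0 : 0 < E) (h1 : E ≤ 1 / 2)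
    (ht : 1 ≤ 2 * t) (htE : 2 * t ^ 2 = Real.log (1 / E)) (hx : 0 ≤ x) :
    Real.log (gaussianPDFReal x 1 (x + z)) - Real.log (mixtureDensity E (x + z)) ≤
      2 * E + (t + 3) * x + (if x ≤ 2 * t then x else 0) * z
        + (if x ≤ 2 * t then 0 else 1 / 2) * (z ^ 2 - 1) := by
  have hg := gaussianPDFReal_pos 0 1 (x + z) one_ne_zero
  have he := Real.exp_pos (-|x + z|)
  split_ifs with hxt
  · have hq : (1 - E) * gaussianPDFReal 0 1 (x + z) ≤ mixtureDensity E (x + z) :=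
      le_add_of_nonneg_right (by positivity)
    have hlq := Real.log_le_log (mul_pos (by linarith) hg) hq
    rw [Real.log_mul (by linarith) hg.ne', log_gaussianPDFReal_one] at hlq
    have hE : -(2 * E) ≤ Real.log (1 - E) := by
      refine le_trans ?_ (Real.one_sub_inv_le_log_of_pos (by linarith : 0 < 1 - E))
      have : (1 - E)⁻¹ ≤ 1 + 2 * E := by
        rw [inv_le_iff_one_le_mul₀ (by linarith)]
        nlinarith
      linarith
    rw [log_gaussianPDFReal_one]
    nlinarith
  · have hq : E / 2 * Real.exp (-|x + z|) ≤ mixtureDensity E (x + z) :=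
      le_add_of_nonneg_left (mul_nonneg (by linarith) hg.le)
    have hlq := Real.log_le_log (by positivity) hq
    rw [Real.log_mul (by positivity) he.ne', Real.log_exp,
      Real.log_div h0.ne' two_ne_zero] at hlq
    rw [one_div, Real.log_inv] at htE
    have hl := Real.log_nonpos (gaussianPDFReal_nonneg x 1 (x + z))
      (gaussianPDFReal_one_le_one x (x + z))
    have h2 := Real.log_two_lt_d9
    have habs := abs_add_le x z
    rw [abs_of_nonneg hx] at habs
    have hz : |z| ≤ (1 + z ^ 2) / 2 := by
      have := sq_nonneg (|z| - 1)
      rw [sub_sq, sq_abs] at this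
      linarith
    push Not at hxt
    nlinarith

lemma integral_sq_gaussianReal : ∫ z, z ^ 2 ∂gaussianReal 0 1 = 1 := by
  have h := variance_eq_sub (memLp_id_gaussianReal (μ := 0) (v := 1) 2)
  rw [variance_id_gaussianReal] at h
  simpa using h.symm

lemma gaussianMI_le {E t : ℝ} (h0 : 0 < E) (h1 : E ≤ 1 / 2) (ht : 1 ≤ 2 * t)
    (htE : 2 * t ^ 2 = Real.log (1 / E)) (μ : Measure ℝ) [IsProbabilityMeasure μ]
    (hneg : μ (Set.Iio 0) = 0) (hmean : ∫⁻ x, ENNReal.ofReal x ∂μ ≤ ENNReal.ofReal E)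
    (htop : gaussianMI μ ≠ ⊤) :
    gaussianMI μ ≤ ((E * (t + 5) : ℝ) : EReal) := by
  have hpos : ∀ᵐ x ∂μ, 0 ≤ x := by
    rw [ae_iff]
    simpa [Set.Iio] using hneg
  have hX : Integrable (fun x : ℝ => x) μ :=
    ⟨measurable_id.aestronglyMeasurable, by
      rw [hasFiniteIntegral_iff_ofReal hpos]
      exact hmean.trans_lt ENNReal.ofReal_lt_top⟩
  have hXE : ∫ x, x ∂μ ≤ E := by
    rw [← ENNReal.ofReal_le_ofReal_iff h0.le, ofReal_integral_eq_lintegral_ofReal hX hpos]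
    exact hmean
  have hZ : Integrable (fun z : ℝ => z) (gaussianReal 0 1) :=
    (memLp_id_gaussianReal (μ := 0) (v := 1) 1).integrable le_rfl
  have hZsq : Integrable (fun z : ℝ => z ^ 2) (gaussianReal 0 1) :=
    (memLp_id_gaussianReal (μ := 0) (v := 1) 2).integrable_sq
  have hZ2 : Integrable (fun z : ℝ => z ^ 2 - 1) (gaussianReal 0 1) :=
    hZsq.sub (integrable_const 1)
  have hZ2' : ∫ z, (z ^ 2 - 1) ∂gaussianReal 0 1 = 0 := by
    rw [integral_sub hZsq (integrable_const 1), integral_sq_gaussianReal]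
    simp
  have hb : Integrable (fun x : ℝ => if x ≤ 2 * t then x else 0) μ :=
    hX.indicator (s := Set.Iic (2 * t)) measurableSet_Iic
  have hc : Integrable (fun x : ℝ => if x ≤ 2 * t then (0 : ℝ) else 1 / 2) μ := by
    refine Integrable.of_bound (C := 1)
      (Measurable.ite measurableSet_Iic measurable_const measurable_const).aestronglyMeasurable
      (ae_of_all _ fun x => ?_)
    split_ifs <;> norm_num
  have hA : Integrable (fun p : ℝ × ℝ => 2 * E + (t + 3) * p.1) (μ.prod (gaussianReal 0 1)) :=
    (integrable_const _).add ((hX.comp_fst _).const_mul _)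
  have hbz := hb.mul_prod hZ
  have hcz := hc.mul_prod hZ2
  refine (gaussianMI_le_of_density μ
    (mixtureDensity_pos h0 (by linarith)) (integrable_mixtureDensity E)
    (integral_mixtureDensity E) ((hA.add hbz).add hcz) ?_ htop).trans ?_
  · filter_upwards [Measure.quasiMeasurePreserving_fst.ae hpos] with p hp
    exact log_gaussianPDFReal_sub_log_mixtureDensity_le h0 h1 ht htE hp
  · rw [EReal.coe_le_coe_iff, integral_add' (hA.add hbz) hcz, integral_add' hA hbz,
      integral_prod_mul (fun x : ℝ => if x ≤ 2 * t then x else 0) (fun z : ℝ => z),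
      integral_prod_mul (fun x : ℝ => if x ≤ 2 * t then (0 : ℝ) else 1 / 2)
        (fun z : ℝ => z ^ 2 - 1), integral_id_gaussianReal, hZ2',
      integral_add (integrable_const _) ((hX.comp_fst _).const_mul _),
      integral_const_mul (t + 3), integral_fun_fst (fun x : ℝ => x)]
    simp only [integral_const, probReal_univ, one_smul, mul_zero, add_zero]
    nlinarith

lemma toReal_C_G_le {E t : ℝ} (h0 : 0 < E) (h1 : E ≤ 1 / 2) (ht : 1 ≤ 2 * t)
    (htE : 2 * t ^ 2 = Real.log (1 / E)) : (C_G E).toReal ≤ E * (t + 5) := by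
  have hnonneg : 0 ≤ E * (t + 5) := mul_nonneg h0.le (by linarith)
  by_cases htop : C_G E = ⊤
  · simpa [htop] using hnonneg
  have hle : C_G E ≤ ((E * (t + 5) : ℝ) : EReal) := by
    refine iSup_le fun μ => iSup_le fun hμ => iSup_le fun hneg => iSup_le fun hmean =>
      gaussianMI_le h0 h1 ht htE μ hneg hmean fun h => htop (top_le_iff.1 ?_)
    rw [← h]
    exact le_iSup_of_le μ (le_iSup_of_le hμ (le_iSup_of_le hneg (le_iSup_of_le hmean le_rfl)))
  by_cases hbot : C_G E = ⊥
  · simpa [hbot] using hnonneg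
  · exact EReal.toReal_le_toReal hle hbot (EReal.coe_ne_top _)

theorem gaussian_low_snr_capacity_upper :
    Filter.limsup (fun E : ℝ => (C_G E).toReal / (E * Real.sqrt (Real.log (1 / E))))
      (nhdsWithin 0 (Set.Ioi 0)) ≤ 1 / Real.sqrt 2 := by
  have hL : Tendsto (fun E : ℝ => Real.log (1 / E)) (nhdsWithin 0 (Set.Ioi 0)) atTop := by
    simp only [one_div]
    exact Real.tendsto_log_atTop.comp tendsto_inv_nhdsGT_zero
  have hsL := Real.tendsto_sqrt_atTop.comp hL
  have hlim : Tendsto (fun E : ℝ => 1 / √2 + 5 / √(Real.log (1 / E)))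
      (nhdsWithin 0 (Set.Ioi 0)) (nhds (1 / √2)) := by
    simpa using (hsL.const_div_atTop 5).const_add (1 / √2)
  have hle : ∀ᶠ E : ℝ in nhdsWithin 0 (Set.Ioi 0),
      (C_G E).toReal / (E * √(Real.log (1 / E))) ≤ 1 / √2 + 5 / √(Real.log (1 / E)) := by
    filter_upwards [self_mem_nhdsWithin, hL.eventually_ge_atTop 1,
      Ioc_mem_nhdsGT (by norm_num : (0 : ℝ) < 1 / 2)] with E h0 hL1 h1
    set L := Real.log (1 / E)
    have h0 : 0 < E := h0
    have hs2 : 0 < √2 := by positivity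
    have hs : 1 ≤ √L := Real.one_le_sqrt.2 hL1
    have hs22 : √2 ≤ 2 := Real.sqrt_le_iff.2 ⟨by norm_num, by norm_num⟩
    have h := toReal_C_G_le (t := √L / √2) h0 h1.2 (by
        rw [← mul_div_assoc, le_div_iff₀ hs2]
        linarith) (by
        rw [div_pow, Real.sq_sqrt (by linarith), Real.sq_sqrt (by norm_num)]
        ring)
    rw [div_le_iff₀ (by positivity)]
    refine h.trans_eq ?_
    field_simp
  refine le_of_forall_gt_imp_ge_of_dense fun a ha => ?_
  by_cases hbdd : BddBelow {a : ℝ | ∀ᶠ E : ℝ in nhdsWithin 0 (Set.Ioi 0),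
      (C_G E).toReal / (E * √(Real.log (1 / E))) ≤ a}
  · rw [limsup_eq]
    refine csInf_le hbdd ?_
    filter_upwards [hle, hlim.eventually_le_const ha] with E h h'
    exact h.trans h'
  · rw [limsup_eq, Real.sInf_of_not_bddBelow hbdd]
    exact (by positivity : (0 : ℝ) ≤ 1 / √2).trans ha.le
end

section
/- Fix a dark current λ > 0 and let C_P(E) denote the capacity of the average-intensity-constrained Poisson optical intensity channel with dark current λ. Then lim_{E → 0⁺} C_P(E) / (E · log log(1/E)) = 1. -/
open MeasureTheory ProbabilityTheory Filter
open scoped Classical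

/-- Mutual information between the input `X ~ μ` and the output `Y` of the Poisson
optical intensity channel with dark current `lam`: conditionally on `X = x`, the
output `Y : ℕ` is Poisson with mean `lam + x`; the mutual information is the KL
divergence between the joint law of `(X, Y)` and the product of its two marginals. -/
noncomputable def poissonMI (lam : ℝ) (μ : Measure ℝ) : EReal :=
  let joint : Measure (ℝ × ℕ) :=
    μ.bind (fun x => (Measure.dirac x).prod (poissonMeasure (Real.toNNReal (lam + x))))
  klDiv joint (joint.fst.prod joint.snd)

/-- Capacity of the average-intensity-constrained Poisson optical intensity channel
with dark current `lam`: the supremum of the mutual information over all probability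
measures on `ℝ` concentrated on `[0, ∞)` with mean at most `E`. -/
noncomputable def C_P (lam : ℝ) (E : ℝ) : EReal :=
  ⨆ (μ : Measure ℝ) (_ : IsProbabilityMeasure μ) (_ : μ (Set.Iio 0) = 0)
    (_ : ∫⁻ x, ENNReal.ofReal x ∂μ ≤ ENNReal.ofReal E), poissonMI lam μ

namespace PoissonChannel

open scoped NNReal

lemma hasSum_poisson_mul_nat {r : ℝ} {g : ℕ → ℝ} {S : ℝ}
    (h : HasSum (fun n : ℕ => Real.exp (-r) * r ^ n / n.factorial * g (n + 1)) S) :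
    HasSum (fun n : ℕ => Real.exp (-r) * r ^ n / n.factorial * (n * g n)) (r * S) := by
  rw [← hasSum_nat_add_iff' 1]
  simp only [Finset.sum_range_one, Nat.cast_zero, zero_mul, mul_zero, sub_zero]
  refine (h.mul_left r).congr_fun ?_
  intro n
  have : (n.factorial : ℝ) ≠ 0 := by positivity
  rw [Nat.factorial_succ]
  push_cast
  field_simp
  ring

lemma hasSum_poisson_mean (r : ℝ≥0) :
    HasSum (fun n : ℕ => Real.exp (-r) * (r : ℝ) ^ n / n.factorial * (n : ℝ)) r := by
  have h := hasSum_poisson_mul_nat (r := r) (g := fun _ => 1) (S := 1)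
    (by simpa using hasSum_one_poissonMeasure r)
  simpa only [mul_one] using h

lemma hasSum_poisson_sq (r : ℝ≥0) :
    HasSum (fun n : ℕ => Real.exp (-r) * (r : ℝ) ^ n / n.factorial * (n : ℝ) ^ 2)
      (r * (r + 1)) := by
  simp_rw [pow_two (Nat.cast _ : ℝ)]
  refine hasSum_poisson_mul_nat (r := r) (g := fun n => (n : ℝ)) ?_
  refine ((hasSum_poisson_mean r).add (hasSum_one_poissonMeasure r)).congr_fun ?_
  intro n
  push_cast
  ring

lemma integrable_natCast_poissonMeasure (r : ℝ≥0) :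
    Integrable (fun n : ℕ => (n : ℝ)) (poissonMeasure r) := by
  rw [integrable_poissonMeasure_iff]
  simpa using (hasSum_poisson_mean r).summable

lemma integral_natCast_poissonMeasure (r : ℝ≥0) :
    ∫ n : ℕ, (n : ℝ) ∂poissonMeasure r = r := by
  rw [integral_poissonMeasure]
  exact (hasSum_poisson_mean r).tsum_eq

lemma integrable_natCast_sq_poissonMeasure (r : ℝ≥0) :
    Integrable (fun n : ℕ => (n : ℝ) ^ 2) (poissonMeasure r) := by
  rw [integrable_poissonMeasure_iff]
  simpa using (hasSum_poisson_sq r).summable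

lemma integral_natCast_sq_poissonMeasure (r : ℝ≥0) :
    ∫ n : ℕ, (n : ℝ) ^ 2 ∂poissonMeasure r = r * (r + 1) := by
  rw [integral_poissonMeasure]
  exact (hasSum_poisson_sq r).tsum_eq

/-- The Poisson channel with dark current `lam`, as a Markov kernel. -/
noncomputable def channel (lam : ℝ) : Kernel ℝ ℕ where
  toFun x := poissonMeasure (Real.toNNReal (lam + x))
  measurable' := by
    refine Measure.measurable_of_measurable_coe _ fun s _ => ?_
    simp_rw [← lintegral_indicator_one (MeasurableSet.of_discrete (s := s)),
      lintegral_countable', poissonMeasure_singleton]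
    fun_prop

lemma channel_apply (lam x : ℝ) :
    channel lam x = poissonMeasure (Real.toNNReal (lam + x)) := rfl

instance (lam : ℝ) : IsMarkovKernel (channel lam) :=
  ⟨fun x => by rw [channel_apply]; infer_instance⟩

/-- The output law of the Poisson channel for the input law `μ`. -/
noncomputable abbrev output (lam : ℝ) (μ : Measure ℝ) : Measure ℕ := channel lam ∘ₘ μ

lemma poissonMI_eq_klDiv (lam : ℝ) (μ : Measure ℝ) [IsProbabilityMeasure μ] :
    poissonMI lam μ = klDiv (μ ⊗ₘ channel lam) (μ.prod (output lam μ)) := by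
  have h : μ.bind (fun x => (Measure.dirac x).prod (poissonMeasure (Real.toNNReal (lam + x))))
      = μ ⊗ₘ channel lam := by
    rw [Measure.compProd_eq_comp_prod]
    congr 1
    ext1 x
    rw [Kernel.prod_apply, Kernel.id_apply, channel_apply]
  simp only [poissonMI, h, Measure.fst_compProd, Measure.snd_compProd]

lemma channel_real_pos {lam x : ℝ} (h : 0 < lam + x) (y : ℕ) : 0 < (channel lam x).real {y} := by
  rw [channel_apply]
  exact poissonMeasure_real_singleton_pos y (Real.toNNReal_pos.2 h)

lemma channel_real_apply {lam x : ℝ} (h : 0 ≤ lam + x) (y : ℕ) :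
    (channel lam x).real {y} = Real.exp (-(lam + x)) * (lam + x) ^ y / y.factorial := by
  rw [channel_apply, poissonMeasure_real_singleton, Real.coe_toNNReal _ h]

lemma output_real_pos {lam : ℝ} (hlam : 0 < lam) {μ : Measure ℝ} [IsProbabilityMeasure μ]
    (hμ : ∀ᵐ x ∂μ, 0 ≤ x) (y : ℕ) : 0 < (output lam μ).real {y} := by
  rw [measureReal_def, ENNReal.toReal_pos_iff]
  refine ⟨?_, measure_lt_top _ _⟩
  rw [Measure.bind_apply (by simp) (Kernel.aemeasurable _), lintegral_pos_iff_support
    (Kernel.measurable_coe _ (by simp))]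
  rw [pos_iff_ne_zero]
  intro h0
  have h1 : ∀ᵐ x ∂μ, False := by
    filter_upwards [hμ, measure_eq_zero_iff_ae_notMem.1 h0] with x hx hx'
    apply hx'
    have := channel_real_pos (lam := lam) (x := x) (by linarith) y
    rw [measureReal_def, ENNReal.toReal_pos_iff] at this
    exact this.1.ne'
  exact IsProbabilityMeasure.ne_zero μ (by simpa using h1)

/-- The information density of the Poisson channel with input law `μ`. -/
noncomputable def infoDensity (lam : ℝ) (μ : Measure ℝ) (z : ℝ × ℕ) : ℝ :=
  Real.log ((channel lam z.1).real {z.2} / (output lam μ).real {z.2})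

lemma measurable_channel_real (lam : ℝ) :
    Measurable fun z : ℝ × ℕ => (channel lam z.1).real {z.2} := by
  refine measurable_from_prod_countable_left fun y => ?_
  exact (Kernel.measurable_coe (channel lam) (MeasurableSet.singleton y)).ennreal_toReal

lemma measurable_likelihoodRatio (lam : ℝ) (ν : Measure ℕ) :
    Measurable fun z : ℝ × ℕ => (channel lam z.1).real {z.2} / ν.real {z.2} :=
  (measurable_channel_real lam).div
    ((measurable_of_countable fun y : ℕ => ν.real {y}).comp measurable_snd)

lemma measurable_infoDensity (lam : ℝ) (μ : Measure ℝ) : Measurable (infoDensity lam μ) :=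
  (measurable_likelihoodRatio lam _).log

lemma compProd_channel_eq_withDensity {lam : ℝ} (hlam : 0 < lam) {μ : Measure ℝ}
    [IsProbabilityMeasure μ] (hμ : ∀ᵐ x ∂μ, 0 ≤ x) :
    μ ⊗ₘ channel lam = (μ.prod (output lam μ)).withDensity fun z =>
      ENNReal.ofReal ((channel lam z.1).real {z.2} / (output lam μ).real {z.2}) := by
  have hm := (measurable_likelihoodRatio lam (output lam μ)).ennreal_ofReal
  refine Measure.ext_of_lintegral _ fun f hf => ?_
  rw [Measure.lintegral_compProd hf, lintegral_withDensity_eq_lintegral_mul _ hm hf,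
    lintegral_prod _ (hm.mul hf).aemeasurable]
  refine lintegral_congr fun x => ?_
  rw [lintegral_countable', lintegral_countable']
  refine tsum_congr fun y => ?_
  have hy := output_real_pos hlam hμ y
  rw [Pi.mul_apply, ENNReal.ofReal_div_of_pos hy, ofReal_measureReal, ofReal_measureReal,
    mul_comm _ (f (x, y)), mul_assoc, ENNReal.div_mul_cancel]
  · rw [measureReal_def, ENNReal.toReal_pos_iff] at hy
    exact hy.1.ne'
  · exact measure_ne_top _ _

lemma ae_compProd_nonneg {lam : ℝ} {μ : Measure ℝ} [IsProbabilityMeasure μ]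
    (hμ : ∀ᵐ x ∂μ, 0 ≤ x) : ∀ᵐ z ∂(μ ⊗ₘ channel lam), 0 ≤ z.1 :=
  Measure.ae_compProd_of_ae_fst _ measurableSet_Ici hμ

lemma poissonMI_eq_integral {lam : ℝ} (hlam : 0 < lam) {μ : Measure ℝ}
    [IsProbabilityMeasure μ] (hμ : ∀ᵐ x ∂μ, 0 ≤ x)
    (hint : Integrable (infoDensity lam μ) (μ ⊗ₘ channel lam)) :
    poissonMI lam μ = ((∫ z, infoDensity lam μ z ∂(μ ⊗ₘ channel lam) : ℝ) : EReal) := by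
  have hac : μ ⊗ₘ channel lam ≪ μ.prod (output lam μ) := by
    rw [compProd_channel_eq_withDensity hlam hμ]
    exact withDensity_absolutelyContinuous _ _
  have hm := (measurable_likelihoodRatio lam (output lam μ)).ennreal_ofReal
  have hrn : (fun z => Real.log (((μ ⊗ₘ channel lam).rnDeriv (μ.prod (output lam μ)) z).toReal))
      =ᵐ[μ ⊗ₘ channel lam] infoDensity lam μ := by
    have := Measure.rnDeriv_withDensity (μ.prod (output lam μ)) hm
    rw [← compProd_channel_eq_withDensity hlam hμ] at this
    filter_upwards [hac.ae_le this] with z hz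
    rw [hz, ENNReal.toReal_ofReal (by positivity), infoDensity]
  rw [poissonMI_eq_klDiv, klDiv, if_pos ⟨hac, hint.congr hrn.symm⟩, integral_congr_ae hrn]

lemma lintegral_ratio_le (P Q : Measure ℕ) [IsFiniteMeasure P] [IsFiniteMeasure Q] :
    ∫⁻ y, ENNReal.ofReal (Q.real {y} / P.real {y}) ∂P ≤ Q Set.univ := by
  rw [lintegral_countable', ← lintegral_one, lintegral_countable']
  refine ENNReal.tsum_le_tsum fun y => ?_
  rw [one_mul]
  rcases eq_or_ne (P {y}) 0 with h | h
  · simp [h]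
  · have hP : 0 < P.real {y} := ENNReal.toReal_pos h (measure_ne_top _ _)
    rw [ENNReal.ofReal_div_of_pos hP,
      ofReal_measureReal, ofReal_measureReal, ENNReal.div_mul_cancel h (measure_ne_top _ _)]

lemma integrable_of_lintegral_ofReal_le {α : Type*} [MeasurableSpace α] {μ : Measure α}
    {f : α → ℝ} (hf : Measurable f) (h0 : 0 ≤ f)
    (h : ∫⁻ a, ENNReal.ofReal (f a) ∂μ ≤ 1) : Integrable f μ ∧ ∫ a, f a ∂μ ≤ 1 := by
  refine ⟨⟨hf.aestronglyMeasurable, ?_⟩, ?_⟩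
  · rw [hasFiniteIntegral_iff_ofReal (ae_of_all _ h0)]
    exact h.trans_lt ENNReal.one_lt_top
  · rw [integral_eq_lintegral_of_nonneg_ae (ae_of_all _ h0) hf.aestronglyMeasurable]
    exact ENNReal.toReal_le_of_le_ofReal zero_le_one (by simpa using h)

lemma ratio_integrable (P Q : Measure ℕ) [IsFiniteMeasure P] [IsProbabilityMeasure Q] :
    Integrable (fun y => Q.real {y} / P.real {y}) P ∧
      ∫ y, Q.real {y} / P.real {y} ∂P ≤ 1 :=
  integrable_of_lintegral_ofReal_le (measurable_of_countable _) (fun y => by positivity)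
    ((lintegral_ratio_le P Q).trans (by simp))

lemma joint_ratio_integrable (lam : ℝ) (μ : Measure ℝ) [IsProbabilityMeasure μ] (Q : Measure ℕ)
    [IsProbabilityMeasure Q] :
    Integrable (fun z : ℝ × ℕ => Q.real {z.2} / (output lam μ).real {z.2}) (μ ⊗ₘ channel lam) ∧
      ∫ z : ℝ × ℕ, Q.real {z.2} / (output lam μ).real {z.2} ∂(μ ⊗ₘ channel lam) ≤ 1 := by
  have hs : output lam μ = (μ ⊗ₘ channel lam).map Prod.snd := (Measure.snd_compProd _ _).symm
  have h := ratio_integrable (output lam μ) Q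
  constructor
  · have h1 := h.1
    conv at h1 => arg 2; rw [hs]
    exact h1.comp_measurable measurable_snd
  · refine le_trans (le_of_eq ?_) h.2
    conv_rhs => arg 1; rw [hs]
    rw [integral_map measurable_snd.aemeasurable
      (measurable_of_countable _).aestronglyMeasurable]

lemma inverse_likelihoodRatio_integrable (lam : ℝ) (μ : Measure ℝ) [IsProbabilityMeasure μ] :
    Integrable (fun z : ℝ × ℕ => (output lam μ).real {z.2} / (channel lam z.1).real {z.2})
      (μ ⊗ₘ channel lam) := by
  have hm : Measurable fun z : ℝ × ℕ =>
      (output lam μ).real {z.2} / (channel lam z.1).real {z.2} :=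
    ((measurable_of_countable fun y : ℕ => (output lam μ).real {y}).comp measurable_snd).div
      (measurable_channel_real lam)
  refine (integrable_of_lintegral_ofReal_le hm (fun z => by positivity) ?_).1
  rw [Measure.lintegral_compProd hm.ennreal_ofReal]
  refine (lintegral_mono fun x => lintegral_ratio_le (channel lam x) (output lam μ)).trans ?_
  simp

lemma mean_integrable {μ : Measure ℝ} (hμ : ∀ᵐ x ∂μ, 0 ≤ x) {E : ℝ} (hE : 0 ≤ E)
    (hm : ∫⁻ x, ENNReal.ofReal x ∂μ ≤ ENNReal.ofReal E) :
    Integrable (fun x : ℝ => x) μ ∧ ∫ x, x ∂μ ≤ E := by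
  refine ⟨⟨measurable_id.aestronglyMeasurable, ?_⟩, ?_⟩
  · rw [hasFiniteIntegral_iff_ofReal hμ]
    exact hm.trans_lt ENNReal.ofReal_lt_top
  · rw [integral_eq_lintegral_of_nonneg_ae hμ measurable_id.aestronglyMeasurable]
    exact ENNReal.toReal_le_of_le_ofReal hE hm

lemma integrable_natCast_channel (lam x : ℝ) :
    Integrable (fun n : ℕ => (n : ℝ)) (channel lam x) :=
  integrable_natCast_poissonMeasure _

lemma integral_natCast_channel {lam x : ℝ} (h : 0 ≤ lam + x) :
    ∫ n : ℕ, (n : ℝ) ∂channel lam x = lam + x := by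
  rw [channel_apply, integral_natCast_poissonMeasure, Real.coe_toNNReal _ h]

lemma measurable_natCast_snd : Measurable fun z : ℝ × ℕ => (z.2 : ℝ) :=
  (measurable_of_countable fun n : ℕ => (n : ℝ)).comp measurable_snd

lemma integrable_snd_joint {lam : ℝ} (hlam : 0 < lam) {μ : Measure ℝ} [IsProbabilityMeasure μ]
    (hμ : ∀ᵐ x ∂μ, 0 ≤ x) (hint : Integrable (fun x : ℝ => x) μ) :
    Integrable (fun z : ℝ × ℕ => (z.2 : ℝ)) (μ ⊗ₘ channel lam) := by
  rw [Measure.integrable_compProd_iff measurable_natCast_snd.aestronglyMeasurable]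
  refine ⟨ae_of_all _ fun x => integrable_natCast_channel lam x, ?_⟩
  refine ((integrable_const lam).add hint).congr ?_
  filter_upwards [hμ] with x hx
  simp only [Pi.add_apply, Real.norm_natCast]
  rw [integral_natCast_channel (by linarith)]

lemma integrable_fst_joint (lam : ℝ) {μ : Measure ℝ} [IsProbabilityMeasure μ] {f : ℝ → ℝ}
    (hint : Integrable f μ) :
    Integrable (fun z : ℝ × ℕ => f z.1) (μ ⊗ₘ channel lam) := by
  have hs : μ = (μ ⊗ₘ channel lam).map Prod.fst := (Measure.fst_compProd _ _).symm
  rw [hs] at hint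
  exact hint.comp_measurable measurable_fst

/-- The geometric law on `ℕ` with ratio `1 / 2`. -/
noncomputable def geometricHalf : Measure ℕ :=
  Measure.sum fun n => ENNReal.ofReal ((1 / 2 : ℝ) ^ (n + 1)) • Measure.dirac n

instance : IsProbabilityMeasure geometricHalf :=
  HasSum.isProbabilityMeasure_sum_dirac (fun _ => by positivity)
    (by simpa [pow_succ, div_eq_mul_inv] using hasSum_geometric_two.mul_right (1 / 2 : ℝ))

lemma geometricHalf_real (n : ℕ) : geometricHalf.real {n} = (1 / 2 : ℝ) ^ (n + 1) := by
  rw [measureReal_def, geometricHalf, Measure.sum_smul_dirac_singleton,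
    ENNReal.toReal_ofReal (by positivity)]

lemma log_geometricHalf (n : ℕ) :
    Real.log (geometricHalf.real {n}) = -((n + 1) * Real.log 2) := by
  rw [geometricHalf_real, Real.log_pow, one_div, Real.log_inv]
  push_cast
  ring

lemma integrable_infoDensity {lam : ℝ} (hlam : 0 < lam) {μ : Measure ℝ} [IsProbabilityMeasure μ]
    (hμ : ∀ᵐ x ∂μ, 0 ≤ x) (hint : Integrable (fun x : ℝ => x) μ) :
    Integrable (infoDensity lam μ) (μ ⊗ₘ channel lam) := by
  have hdom := ((inverse_likelihoodRatio_integrable lam μ).add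
    (joint_ratio_integrable lam μ geometricHalf).1).add
    (((integrable_snd_joint hlam hμ hint).add (integrable_const 1)).mul_const (Real.log 2))
  refine hdom.mono' (measurable_infoDensity lam μ).aestronglyMeasurable ?_
  filter_upwards [ae_compProd_nonneg hμ] with z hz
  have hP := channel_real_pos (lam := lam) (x := z.1) (by linarith) z.2
  have hν := output_real_pos hlam hμ z.2
  have hG : 0 < geometricHalf.real {z.2} := by rw [geometricHalf_real]; positivity
  have hP1 : (channel lam z.1).real {z.2} ≤ 1 := measureReal_le_one
  have h1 := Real.log_le_sub_one_of_pos (div_pos hν hP)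
  have h2 := Real.log_le_sub_one_of_pos (div_pos hG hν)
  have h3 := Real.log_nonpos hP.le hP1
  have h4 := div_pos hν hP
  have h5 := div_pos hG hν
  have h6 : 0 ≤ ((z.2 : ℝ) + 1) * Real.log 2 := by positivity
  rw [Real.log_div hν.ne' hP.ne'] at h1
  rw [Real.log_div hG.ne' hν.ne', log_geometricHalf] at h2
  simp only [Pi.add_apply]
  rw [Real.norm_eq_abs, abs_le, infoDensity, Real.log_div hP.ne' hν.ne']
  constructor <;> linarith

lemma integral_infoDensity_le {lam : ℝ} (hlam : 0 < lam) {μ : Measure ℝ} [IsProbabilityMeasure μ]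
    (hμ : ∀ᵐ x ∂μ, 0 ≤ x) (hint : Integrable (fun x : ℝ => x) μ)
    (Q : Measure ℕ) [IsProbabilityMeasure Q] (hQ : ∀ y, 0 < Q.real {y}) {G : ℝ × ℕ → ℝ}
    (hG : Integrable G (μ ⊗ₘ channel lam))
    (hle : ∀ x : ℝ, 0 ≤ x → ∀ y : ℕ, Real.log ((channel lam x).real {y} / Q.real {y}) ≤ G (x, y)) :
    ∫ z, infoDensity lam μ z ∂(μ ⊗ₘ channel lam) ≤ ∫ z, G z ∂(μ ⊗ₘ channel lam) := by
  have hr := joint_ratio_integrable lam μ Q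
  have hI := integrable_infoDensity hlam hμ hint
  have key : ∫ z, infoDensity lam μ z ∂(μ ⊗ₘ channel lam) ≤
      ∫ z, (G z + (Q.real {z.2} / (output lam μ).real {z.2} - 1)) ∂(μ ⊗ₘ channel lam) := by
    refine integral_mono_ae hI (hG.add (hr.1.sub (integrable_const 1))) ?_
    filter_upwards [ae_compProd_nonneg hμ] with z hz
    have hP := channel_real_pos (lam := lam) (x := z.1) (by linarith) z.2
    have hν := output_real_pos hlam hμ z.2
    have h1 := Real.log_le_sub_one_of_pos (div_pos (hQ z.2) hν)
    have h2 := hle z.1 hz z.2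
    rw [Real.log_div (hQ z.2).ne' hν.ne'] at h1
    rw [Real.log_div hP.ne' (hQ z.2).ne'] at h2
    rw [infoDensity, Real.log_div hP.ne' hν.ne']
    linarith
  have hsub : Integrable (fun z : ℝ × ℕ => Q.real {z.2} / (output lam μ).real {z.2} - 1)
      (μ ⊗ₘ channel lam) := hr.1.sub (integrable_const 1)
  rw [integral_add hG hsub, integral_sub hr.1 (integrable_const 1)] at key
  have := hr.2
  simp only [integral_const, probReal_univ, smul_eq_mul, mul_one] at key
  linarith

/-- The mixture `(1 - η) Po(lam) + η Geom(1/2)`. -/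
noncomputable def mixture (lam η : ℝ) : Measure ℕ :=
  ENNReal.ofReal (1 - η) • channel lam 0 + ENNReal.ofReal η • geometricHalf

lemma isProbabilityMeasure_mixture (lam : ℝ) {η : ℝ} (h0 : 0 ≤ η) (h1 : η ≤ 1) :
    IsProbabilityMeasure (mixture lam η) := by
  constructor
  simp [mixture, ← ENNReal.ofReal_add (sub_nonneg.2 h1) h0]

lemma mixture_real (lam : ℝ) {η : ℝ} (h0 : 0 ≤ η) (h1 : η ≤ 1) (y : ℕ) :
    (mixture lam η).real {y} =
      (1 - η) * (channel lam 0).real {y} + η * geometricHalf.real {y} := by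
  rw [mixture, measureReal_def, Measure.add_apply, Measure.smul_apply, Measure.smul_apply,
    smul_eq_mul, smul_eq_mul,
    ENNReal.toReal_add (ENNReal.mul_ne_top ENNReal.ofReal_ne_top (measure_ne_top _ _))
      (ENNReal.mul_ne_top ENNReal.ofReal_ne_top (measure_ne_top _ _)),
    ENNReal.toReal_mul, ENNReal.toReal_mul, ENNReal.toReal_ofReal (sub_nonneg.2 h1),
    ENNReal.toReal_ofReal h0]
  rfl

lemma log_channel_div {lam x : ℝ} (hlam : 0 < lam) (hx : 0 ≤ x) (y : ℕ) :
    Real.log ((channel lam x).real {y} / (channel lam 0).real {y}) =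
      -x + y * Real.log (1 + x / lam) := by
  have h1 : 0 < 1 + x / lam := by positivity
  have : (channel lam x).real {y} / (channel lam 0).real {y} =
      Real.exp (-x) * (1 + x / lam) ^ y := by
    rw [channel_real_apply (by linarith), channel_real_apply (by linarith)]
    have e : lam + x = lam * (1 + x / lam) := by field_simp
    have hl : lam ^ y ≠ 0 := by positivity
    have hf : (y.factorial : ℝ) ≠ 0 := by positivity
    have he := (Real.exp_pos (-lam)).ne'
    rw [neg_add, Real.exp_add, add_zero, e, mul_pow]
    field_simp
  rw [this, Real.log_mul (Real.exp_pos _).ne' (by positivity), Real.log_exp, Real.log_pow]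

lemma log_channel_div_mixture_le {lam E x : ℝ} (hlam : 0 < lam) (hE : 0 < E) (hE' : E ≤ 1 / 2)
    (hx : 0 ≤ x) (y : ℕ) :
    Real.log ((channel lam x).real {y} / (mixture lam E).real {y}) ≤
      2 * E - x + y * Real.log (1 + x / lam) ∧
    Real.log ((channel lam x).real {y} / (mixture lam E).real {y}) ≤
      Real.log (1 / E) + (y + 1) * Real.log 2 := by
  have hP := channel_real_pos (lam := lam) (x := x) (by linarith) y
  have hP0 := channel_real_pos (lam := lam) (x := 0) (by linarith) y
  have hP1 : (channel lam x).real {y} ≤ 1 := measureReal_le_one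
  have hG : 0 < geometricHalf.real {y} := by rw [geometricHalf_real]; positivity
  have hQ := mixture_real lam hE.le (by linarith) y
  have h1E : 0 < 1 - E := by linarith
  have hQpos : 0 < (mixture lam E).real {y} := by rw [hQ]; positivity
  rw [Real.log_div hP.ne' hQpos.ne']
  constructor
  · have h1 : Real.log ((1 - E) * (channel lam 0).real {y}) ≤
        Real.log ((mixture lam E).real {y}) := by
      refine Real.log_le_log (by positivity) ?_
      rw [hQ]
      have : 0 < E * geometricHalf.real {y} := by positivity
      linarith
    rw [Real.log_mul h1E.ne' hP0.ne'] at h1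
    have h2 := log_channel_div hlam hx y
    rw [Real.log_div hP.ne' hP0.ne'] at h2
    have h3 := Real.one_sub_inv_le_log_of_pos h1E
    have h4 : (1 - E)⁻¹ ≤ 1 + 2 * E := by
      rw [inv_le_iff_one_le_mul₀ h1E]
      nlinarith
    linarith
  · have h1 : Real.log (E * geometricHalf.real {y}) ≤ Real.log ((mixture lam E).real {y}) := by
      refine Real.log_le_log (by positivity) ?_
      rw [hQ]
      have : 0 < (1 - E) * (channel lam 0).real {y} := by positivity
      linarith
    rw [Real.log_mul hE.ne' hG.ne', log_geometricHalf] at h1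
    rw [one_div, Real.log_inv]
    have := Real.log_nonpos hP.le hP1
    linarith

lemma integrable_integral_channel {lam : ℝ} {μ : Measure ℝ} [IsProbabilityMeasure μ]
    {f : ℝ × ℕ → ℝ} (hf : Integrable f (μ ⊗ₘ channel lam)) :
    Integrable (fun x => ∫ y, f (x, y) ∂channel lam x) μ := by
  rw [Measure.compProd] at hf
  simpa using hf.integral_compProd

lemma integral_infoDensity_le_of_mean_le {lam E : ℝ} (hlam : 0 < lam) (hE : 0 < E)
    (hE' : E ≤ 1 / 2) (hl : 1 ≤ Real.log (1 / E))
    {μ : Measure ℝ} [IsProbabilityMeasure μ] (hμ : ∀ᵐ x ∂μ, 0 ≤ x)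
    (hm : ∫⁻ x, ENNReal.ofReal x ∂μ ≤ ENNReal.ofReal E) :
    ∫ z, infoDensity lam μ z ∂(μ ⊗ₘ channel lam) ≤
      (2 + max (Real.log (1 + Real.log (1 / E) / lam)) (lam + 3)) * E := by
  obtain ⟨hint, hmean⟩ := mean_integrable hμ hE.le hm
  set l := Real.log (1 / E) with hl_def
  set K := max (Real.log (1 + l / lam)) (lam + 3) with hK
  have hK0 : 0 ≤ K := le_max_of_le_right (by linarith)
  have hlog2 : 0 < Real.log 2 := Real.log_pos (by norm_num)
  have hlog2' : Real.log 2 ≤ 1 := by linarith [Real.log_two_lt_d9]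
  let a : ℝ → ℝ := fun x => if x ≤ l then 2 * E - x else l + Real.log 2
  let b : ℝ → ℝ := fun x => if x ≤ l then Real.log (1 + x / lam) else Real.log 2
  have ha : Measurable a := Measurable.ite measurableSet_Iic (by fun_prop) (by fun_prop)
  have hb : Measurable b := Measurable.ite measurableSet_Iic (by fun_prop) (by fun_prop)
  have hb0 : ∀ x, 0 ≤ x → 0 ≤ b x := by
    intro x hx
    simp only [b]
    split_ifs
    · exact Real.log_nonneg (by have : 0 ≤ x / lam := by positivity
                                linarith)
    · exact hlog2.le
  have hb1 : ∀ x, 0 ≤ x → b x ≤ K := by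
    intro x hx
    simp only [b]
    split_ifs with h
    · refine le_max_of_le_left (Real.log_le_log (by positivity) ?_)
      gcongr
    · exact le_max_of_le_right (by linarith)
  have hai : Integrable a μ := by
    refine ((integrable_const (2 * E + l + Real.log 2)).add hint).mono'
      ha.aestronglyMeasurable ?_
    filter_upwards [hμ] with x hx
    simp only [a, Pi.add_apply, Real.norm_eq_abs, abs_le]
    split_ifs <;> constructor <;> linarith
  have hbi : Integrable (fun z : ℝ × ℕ => b z.1 * (z.2 : ℝ)) (μ ⊗ₘ channel lam) := by
    refine ((integrable_snd_joint hlam hμ hint).const_mul K).mono'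
      ((hb.comp measurable_fst).mul measurable_natCast_snd).aestronglyMeasurable ?_
    filter_upwards [ae_compProd_nonneg hμ] with z hz
    rw [norm_mul, Real.norm_natCast, Real.norm_of_nonneg (hb0 _ hz)]
    have := hb1 _ hz
    gcongr
  have hGi : Integrable (fun z : ℝ × ℕ => a z.1 + b z.1 * (z.2 : ℝ)) (μ ⊗ₘ channel lam) :=
    (integrable_fst_joint lam hai).add hbi
  have := isProbabilityMeasure_mixture lam hE.le (by linarith : E ≤ 1)
  have hQpos : ∀ y, 0 < (mixture lam E).real {y} := by
    intro y
    have hG : 0 < geometricHalf.real {y} := by rw [geometricHalf_real]; positivity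
    have h1E : 0 < 1 - E := by linarith
    rw [mixture_real lam hE.le (by linarith)]
    positivity
  refine (integral_infoDensity_le hlam hμ hint (mixture lam E) hQpos hGi ?_).trans ?_
  · intro x hx y
    obtain ⟨h1, h2⟩ := log_channel_div_mixture_le hlam hE hE' hx y
    simp only [a, b]
    split_ifs <;> linarith
  rw [Measure.integral_compProd hGi]
  have hle : ∫ x, ∫ y, (a x + b x * ((y : ℕ) : ℝ)) ∂channel lam x ∂μ ≤
      ∫ x, (2 * E + K * x) ∂μ := by
    refine integral_mono_ae (integrable_integral_channel hGi)
      ((integrable_const _).add (hint.const_mul K)) ?_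
    filter_upwards [hμ] with x hx
    change ∫ y, (a x + b x * ((y : ℕ) : ℝ)) ∂channel lam x ≤ _
    rw [integral_add (integrable_const _) ((integrable_natCast_channel lam x).const_mul _),
      integral_const_mul, integral_natCast_channel (by linarith)]
    simp only [integral_const, probReal_univ, smul_eq_mul, one_mul]
    simp only [a, b]
    split_ifs with h
    · have hpos : 0 < 1 + x / lam := by positivity
      have h1 : Real.log (1 + x / lam) ≤ x / lam := by
        linarith [Real.log_le_sub_one_of_pos hpos]
      have h2 : lam * Real.log (1 + x / lam) ≤ x := by
        calc _ ≤ lam * (x / lam) := by gcongr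
          _ = x := by field_simp
      have h3 : Real.log (1 + x / lam) ≤ K := by
        have := hb1 x hx
        simp only [b, if_pos h] at this
        exact this
      nlinarith
    · push Not at h
      have h3 : lam + 3 ≤ K := le_max_right _ _
      nlinarith [mul_le_mul_of_nonneg_right h3 hx]
  refine hle.trans ?_
  have hmul : ∫ x, K * x ∂μ = K * ∫ x, x ∂μ := integral_const_mul _ _
  rw [integral_add (integrable_const _) (hint.const_mul K), hmul]
  simp only [integral_const, probReal_univ, smul_eq_mul, one_mul]
  linarith [mul_le_mul_of_nonneg_left hmean hK0]

lemma C_P_le {lam E : ℝ} (hlam : 0 < lam) (hE : 0 < E)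
    (hE' : E ≤ 1 / 2) (hl : 1 ≤ Real.log (1 / E)) :
    C_P lam E ≤
      (((2 + max (Real.log (1 + Real.log (1 / E) / lam)) (lam + 3)) * E : ℝ) : EReal) := by
  refine iSup_le fun μ => iSup_le fun _ => iSup_le fun h0 => iSup_le fun hm => ?_
  have hμ : ∀ᵐ x ∂μ, 0 ≤ x := by
    filter_upwards [measure_eq_zero_iff_ae_notMem.1 h0] with x hx
    simpa using hx
  rw [poissonMI_eq_integral hlam hμ
    (integrable_infoDensity hlam hμ (mean_integrable hμ hE.le hm).1), EReal.coe_le_coe_iff]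
  exact integral_infoDensity_le_of_mean_le hlam hE hE' hl hμ hm

/-- The on-off input law putting mass `p` at `a` and mass `1 - p` at `0`. -/
noncomputable def onOff (p a : ℝ) : Measure ℝ :=
  ENNReal.ofReal (1 - p) • Measure.dirac 0 + ENNReal.ofReal p • Measure.dirac a

lemma isProbabilityMeasure_onOff {p : ℝ} (a : ℝ) (h0 : 0 ≤ p) (h1 : p ≤ 1) :
    IsProbabilityMeasure (onOff p a) := by
  constructor
  simp [onOff, ← ENNReal.ofReal_add (sub_nonneg.2 h1) h0]

lemma lintegral_onOff {p : ℝ} (a : ℝ) (h0 : 0 ≤ p) :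
    ∫⁻ x, ENNReal.ofReal x ∂onOff p a = ENNReal.ofReal (p * a) := by
  simp [onOff, lintegral_add_measure, lintegral_smul_measure, ENNReal.ofReal_mul h0]

lemma onOff_nonneg {p a : ℝ} (ha : 0 ≤ a) : ∀ᵐ x ∂onOff p a, 0 ≤ x := by
  rw [onOff, ae_add_measure_iff]
  constructor <;> refine Measure.ae_smul_measure ?_ _ <;> simp [ae_dirac_eq, ha]

lemma integral_onOff {p a : ℝ} (h0 : 0 ≤ p) (h1 : p ≤ 1) (f : ℝ → ℝ) :
    ∫ x, f x ∂onOff p a = (1 - p) * f 0 + p * f a := by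
  have hi : ∀ x : ℝ, Integrable f (Measure.dirac x) := fun x =>
    integrable_dirac (by simp)
  rw [onOff, integral_add_measure ((hi 0).smul_measure ENNReal.ofReal_ne_top)
    ((hi a).smul_measure ENNReal.ofReal_ne_top), integral_smul_measure, integral_smul_measure,
    integral_dirac, integral_dirac, ENNReal.toReal_ofReal (sub_nonneg.2 h1),
    ENNReal.toReal_ofReal h0, smul_eq_mul, smul_eq_mul]

lemma output_onOff_real (lam : ℝ) {p : ℝ} (a : ℝ) (h0 : 0 ≤ p) (h1 : p ≤ 1) (y : ℕ) :
    (output lam (onOff p a)).real {y} =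
      (1 - p) * (channel lam 0).real {y} + p * (channel lam a).real {y} := by
  rw [output, onOff, Measure.comp_add, Measure.comp_smul, Measure.comp_smul,
    Measure.dirac_bind (Kernel.measurable _), Measure.dirac_bind (Kernel.measurable _),
    measureReal_def, Measure.add_apply, Measure.smul_apply, Measure.smul_apply,
    smul_eq_mul, smul_eq_mul,
    ENNReal.toReal_add (ENNReal.mul_ne_top ENNReal.ofReal_ne_top (measure_ne_top _ _))
      (ENNReal.mul_ne_top ENNReal.ofReal_ne_top (measure_ne_top _ _)),
    ENNReal.toReal_mul, ENNReal.toReal_mul, ENNReal.toReal_ofReal (sub_nonneg.2 h1),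
    ENNReal.toReal_ofReal h0]
  rfl

lemma integral_infoDensity_zero_nonneg {lam : ℝ} (hlam : 0 < lam) {μ : Measure ℝ}
    [IsProbabilityMeasure μ] (hμ : ∀ᵐ x ∂μ, 0 ≤ x) {x : ℝ} (hx : 0 ≤ x) :
    0 ≤ ∫ y, infoDensity lam μ (x, y) ∂channel lam x := by
  by_cases hi : Integrable (fun y => infoDensity lam μ (x, y)) (channel lam x)
  · have hr := ratio_integrable (channel lam x) (output lam μ)
    have h : ∫ y, (1 - (output lam μ).real {y} / (channel lam x).real {y}) ∂channel lam x ≤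
        ∫ y, infoDensity lam μ (x, y) ∂channel lam x := by
      refine integral_mono ((integrable_const 1).sub hr.1) hi fun y => ?_
      have hP := channel_real_pos (lam := lam) (x := x) (by linarith) y
      have hν := output_real_pos hlam hμ y
      have h1 := Real.log_le_sub_one_of_pos (div_pos hν hP)
      rw [Real.log_div hν.ne' hP.ne'] at h1
      simp only [infoDensity]
      rw [Real.log_div hP.ne' hν.ne']
      linarith
    rw [integral_sub (integrable_const 1) hr.1] at h
    simp only [integral_const, probReal_univ, smul_eq_mul, mul_one] at h
    linarith [hr.2]
  · rw [integral_undef hi]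

lemma log_one_add_exp_le {l u : ℝ} (hl : 0 < l) :
    Real.log (1 + Real.exp (-l + u)) ≤ Real.log 2 + u ^ 2 / (4 * l) := by
  have h1 : -l + u ≤ u ^ 2 / (4 * l) := by
    rw [le_div_iff₀ (by positivity)]
    nlinarith [sq_nonneg (u - 2 * l)]
  have h2 : 0 ≤ u ^ 2 / (4 * l) := by positivity
  rw [← Real.log_exp (u ^ 2 / (4 * l)), ← Real.log_mul (by norm_num) (Real.exp_pos _).ne']
  refine Real.log_le_log (by positivity) ?_
  linarith [Real.exp_le_exp.2 h1, Real.one_le_exp h2]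

lemma infoDensity_onOff_ge {lam l p a : ℝ} (hlam : 0 < lam) (hl : 0 < l) (hp : 0 < p)
    (hp' : p ≤ Real.exp (-l)) (ha : 0 ≤ a) (y : ℕ) :
    -a + y * Real.log (1 + a / lam) -
        (Real.log 2 + Real.log (1 + a / lam) ^ 2 / (4 * l) * (y : ℝ) ^ 2) ≤
      infoDensity lam (onOff p a) (a, y) := by
  have hp1 : p ≤ 1 := hp'.trans (Real.exp_le_one_iff.2 (by linarith))
  have hP := channel_real_pos (lam := lam) (x := a) (by linarith) y
  have hP0 := channel_real_pos (lam := lam) (x := 0) (by linarith) y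
  set s := Real.log (1 + a / lam) with hs
  have hlog := log_channel_div hlam ha y
  have hν := output_onOff_real lam a hp.le hp1 y
  have hνpos : 0 < (output lam (onOff p a)).real {y} := by
    rw [hν]
    have : 0 ≤ 1 - p := by linarith
    positivity
  have hratio : (channel lam a).real {y} =
      (channel lam 0).real {y} * Real.exp (-a + y * s) := by
    rw [← hlog, Real.exp_log (div_pos hP hP0)]
    field_simp
  have hle : (output lam (onOff p a)).real {y} ≤
      (channel lam 0).real {y} * (1 + Real.exp (-l + y * s)) := by
    have h1 : p * Real.exp (-a + y * s) ≤ Real.exp (-l + y * s) := by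
      calc p * Real.exp (-a + y * s) ≤ Real.exp (-l) * Real.exp (y * s) := by
            gcongr
            linarith
        _ = _ := (Real.exp_add _ _).symm
    rw [hν, hratio]
    nlinarith [mul_le_mul_of_nonneg_left h1 hP0.le, mul_pos hp hP0]
  have h2 := Real.log_le_log hνpos hle
  rw [Real.log_mul hP0.ne' (by positivity)] at h2
  have h3 := log_one_add_exp_le (u := y * s) hl
  have h4 : ((y : ℝ) * s) ^ 2 / (4 * l) = s ^ 2 / (4 * l) * (y : ℝ) ^ 2 := by ring
  rw [Real.log_div hP.ne' hP0.ne'] at hlog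
  simp only [infoDensity]
  rw [Real.log_div hP.ne' hνpos.ne']
  linarith

lemma integral_infoDensity_onOff_ge {lam l p a : ℝ} (hlam : 0 < lam) (hl : 0 < l) (hp : 0 < p)
    (hp' : p ≤ Real.exp (-l)) (ha : 0 ≤ a)
    (hint : Integrable (fun y => infoDensity lam (onOff p a) (a, y)) (channel lam a)) :
    -a + (lam + a) * Real.log (1 + a / lam) -
        (Real.log 2 + Real.log (1 + a / lam) ^ 2 / (4 * l) * ((lam + a) * (lam + a + 1))) ≤
      ∫ y, infoDensity lam (onOff p a) (a, y) ∂channel lam a := by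
  set s := Real.log (1 + a / lam) with hs
  have h1 : Integrable (fun y : ℕ => -a + y * s) (channel lam a) :=
    (integrable_const _).add ((integrable_natCast_channel lam a).mul_const s)
  have hsq : Integrable (fun y : ℕ => s ^ 2 / (4 * l) * (y : ℝ) ^ 2) (channel lam a) :=
    (integrable_natCast_sq_poissonMeasure _).const_mul _
  have h2 : Integrable (fun y : ℕ => Real.log 2 + s ^ 2 / (4 * l) * (y : ℝ) ^ 2)
      (channel lam a) := (integrable_const _).add hsq
  have h := integral_mono (h1.sub h2) hint fun y => infoDensity_onOff_ge hlam hl hp hp' ha y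
  refine le_trans (le_of_eq ?_) h
  have e1 : ∫ y : ℕ, (y : ℝ) * s ∂channel lam a = (lam + a) * s := by
    rw [integral_mul_const, integral_natCast_channel (by linarith)]
  have e2 : ∫ y : ℕ, s ^ 2 / (4 * l) * (y : ℝ) ^ 2 ∂channel lam a =
      s ^ 2 / (4 * l) * ((lam + a) * (lam + a + 1)) := by
    rw [integral_const_mul, channel_apply, integral_natCast_sq_poissonMeasure,
      Real.coe_toNNReal _ (by linarith)]
  simp only [Pi.sub_apply]
  rw [integral_sub h1 h2, integral_add (integrable_const _)
    ((integrable_natCast_channel lam a).mul_const s), integral_add (integrable_const _) hsq,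
    e1, e2]
  simp only [integral_const, probReal_univ, smul_eq_mul, one_mul]

lemma le_C_P {lam E a : ℝ} (hlam : 0 < lam) (hE : 0 < E) (hl : 0 < Real.log (1 / E))
    (ha : 1 ≤ a) :
    ((E / a * (-a + (lam + a) * Real.log (1 + a / lam) -
        (Real.log 2 + Real.log (1 + a / lam) ^ 2 / (4 * Real.log (1 / E)) *
          ((lam + a) * (lam + a + 1)))) : ℝ) : EReal) ≤ C_P lam E := by
  set p := E / a with hp_def
  have ha0 : 0 < a := by linarith
  have hp : 0 < p := by positivity
  have hp' : p ≤ Real.exp (-Real.log (1 / E)) := by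
    rw [one_div, Real.log_inv, neg_neg, Real.exp_log hE]
    exact div_le_self hE.le ha
  have hp1 : p ≤ 1 := hp'.trans (Real.exp_le_one_iff.2 (by linarith))
  have hprob := isProbabilityMeasure_onOff a hp.le hp1
  have hμ := onOff_nonneg (p := p) ha0.le
  have hm : ∫⁻ x, ENNReal.ofReal x ∂onOff p a ≤ ENNReal.ofReal E := by
    rw [lintegral_onOff a hp.le, hp_def, div_mul_cancel₀ _ ha0.ne']
  have h0 : onOff p a (Set.Iio 0) = 0 := by
    rw [measure_eq_zero_iff_ae_notMem]
    filter_upwards [hμ] with x hx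
    simpa using hx
  have hI := integrable_infoDensity hlam hμ (mean_integrable hμ hE.le hm).1
  have hIa : Integrable (fun y => infoDensity lam (onOff p a) (a, y)) (channel lam a) := by
    have h := ((Measure.integrable_compProd_iff
      (measurable_infoDensity lam (onOff p a)).aestronglyMeasurable).1 hI).1
    have hp0 : ENNReal.ofReal p ≠ 0 := by simpa using hp
    have h' := (ae_add_measure_iff.1 h).2
    rw [Measure.ae_ennreal_smul_measure_iff hp0, ae_dirac_eq] at h'
    exact h'
  have hMI : poissonMI lam (onOff p a) ≤ C_P lam E :=
    le_iSup_of_le (onOff p a) (le_iSup_of_le hprob (le_iSup_of_le h0 (le_iSup_of_le hm le_rfl)))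
  refine le_trans ?_ hMI
  rw [poissonMI_eq_integral hlam hμ hI, EReal.coe_le_coe_iff, Measure.integral_compProd hI,
    integral_onOff hp.le hp1]
  have hz := integral_infoDensity_zero_nonneg hlam hμ le_rfl
  have hF := integral_infoDensity_onOff_ge hlam hl hp hp' ha0.le hIa
  have := mul_le_mul_of_nonneg_left hF hp.le
  have := mul_nonneg (sub_nonneg.2 hp1) hz
  linarith

lemma tendsto_log_one_div_nhdsGT_zero :
    Tendsto (fun E : ℝ => Real.log (1 / E)) (nhdsWithin 0 (Set.Ioi 0)) atTop := by
  simp_rw [one_div]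
  exact Real.tendsto_log_atTop.comp tendsto_inv_nhdsGT_zero

lemma C_P_toReal_bounds {lam E a : ℝ} (hlam : 0 < lam) (hE : 0 < E) (hE' : E ≤ 1 / 2)
    (hl : 1 ≤ Real.log (1 / E)) (ha : 1 ≤ a) :
    E / a * (-a + (lam + a) * Real.log (1 + a / lam) -
        (Real.log 2 + Real.log (1 + a / lam) ^ 2 / (4 * Real.log (1 / E)) *
          ((lam + a) * (lam + a + 1)))) ≤ (C_P lam E).toReal ∧
    (C_P lam E).toReal ≤
      (2 + max (Real.log (1 + Real.log (1 / E) / lam)) (lam + 3)) * E := by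
  have h1 := le_C_P hlam hE (by linarith) ha
  have h2 := C_P_le hlam hE hE' hl
  have hbot : C_P lam E ≠ ⊥ := ne_bot_of_le_ne_bot (EReal.coe_ne_bot _) h1
  have htop : C_P lam E ≠ ⊤ := ne_top_of_le_ne_top (EReal.coe_ne_top _) h2
  lift C_P lam E to ℝ using ⟨htop, hbot⟩ with c
  exact ⟨EReal.coe_le_coe_iff.1 h1, EReal.coe_le_coe_iff.1 h2⟩

lemma onOff_rate_ge {lam l m a : ℝ} (hlam : 0 < lam) (hm : m = Real.log l) (hm1 : 1 ≤ m)
    (hl : 2 ≤ l) (hmlam : 2 / lam ≤ m ^ 2) (haeq : a = l / m ^ 2) (ha : lam + 1 ≤ a) :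
    a * (m - (2 * Real.log m + (Real.log lam + 3))) ≤
      -a + (lam + a) * Real.log (1 + a / lam) -
        (Real.log 2 + Real.log (1 + a / lam) ^ 2 / (4 * l) * ((lam + a) * (lam + a + 1))) := by
  have hm0 : 0 < m := by linarith
  have hl0 : 0 < l := by linarith
  have ha0 : 0 < a := by linarith
  set s := Real.log (1 + a / lam) with hs
  have hs0 : 0 ≤ s := Real.log_nonneg (by have : 0 ≤ a / lam := by positivity
                                          linarith)
  have hsm : s ≤ m := by
    rw [hm]
    refine Real.log_le_log (by positivity) ?_
    have : a / lam ≤ l / 2 := by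
      rw [haeq, div_div, div_le_div_iff_of_pos_left hl0 (by positivity) (by norm_num)]
      rwa [div_le_iff₀ hlam] at hmlam
    linarith
  have hs_ge : m - 2 * Real.log m - Real.log lam ≤ s := by
    have h1 : Real.log (a / lam) ≤ s := Real.log_le_log (by positivity) (by linarith)
    rw [Real.log_div ha0.ne' hlam.ne', haeq, Real.log_div hl0.ne' (by positivity),
      Real.log_pow, ← hm] at h1
    push_cast at h1
    linarith
  have hquad : s ^ 2 / (4 * l) * ((lam + a) * (lam + a + 1)) ≤ a := by
    calc s ^ 2 / (4 * l) * ((lam + a) * (lam + a + 1))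
        ≤ m ^ 2 / (4 * l) * ((2 * a) * (2 * a)) := by
          gcongr <;> linarith
      _ = a * (m ^ 2 / l * a) := by ring
      _ = a := by
          rw [haeq]
          field_simp
  have hlog2 : Real.log 2 ≤ a := by linarith [Real.log_two_lt_d9]
  have := mul_le_mul_of_nonneg_left hs_ge ha0.le
  have := mul_nonneg hlam.le hs0
  nlinarith

lemma tendsto_lower_ratio (c : ℝ) :
    Tendsto (fun m : ℝ => (m - (2 * Real.log m + c)) / m) atTop (nhds 1) := by
  have h1 : Tendsto (fun m : ℝ => Real.log m / m) atTop (nhds 0) :=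
    Real.isLittleO_log_id_atTop.tendsto_div_nhds_zero
  have h2 : Tendsto (fun m : ℝ => c / m) atTop (nhds 0) := tendsto_id.const_div_atTop c
  have h3 := (tendsto_const_nhds (x := (1 : ℝ))).sub ((h1.const_mul 2).add h2)
  simp only [mul_zero, add_zero, sub_zero] at h3
  refine h3.congr' ?_
  filter_upwards [eventually_gt_atTop 0] with m hm
  field_simp

lemma tendsto_upper_ratio (c : ℝ) :
    Tendsto (fun m : ℝ => (m + c) / m) atTop (nhds 1) := by
  have h2 : Tendsto (fun m : ℝ => c / m) atTop (nhds 0) := tendsto_id.const_div_atTop c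
  have h3 := (tendsto_const_nhds (x := (1 : ℝ))).add h2
  simp only [add_zero] at h3
  refine h3.congr' ?_
  filter_upwards [eventually_gt_atTop 0] with m hm
  field_simp

lemma eventually_log_sq_le {c : ℝ} (hc : 0 < c) :
    ∀ᶠ l : ℝ in atTop, c ≤ l / Real.log l ^ 2 := by
  have h := (Real.isLittleO_pow_log_id_atTop (n := 2)).bound (inv_pos.2 hc)
  filter_upwards [h, eventually_gt_atTop 1] with l hl hl1
  have hlog : 0 < Real.log l := Real.log_pos hl1
  rw [le_div_iff₀ (by positivity)]
  rw [id, Real.norm_of_nonneg (by positivity), Real.norm_of_nonneg (by linarith),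
    le_inv_mul_iff₀ hc] at hl
  exact hl

end PoissonChannel

open PoissonChannel in
theorem poisson_low_snr_asymptotic_capacity {lam : ℝ} (hlam : 0 < lam) :
    Filter.Tendsto
      (fun E : ℝ => (C_P lam E).toReal / (E * Real.log (Real.log (1 / E))))
      (nhdsWithin 0 (Set.Ioi 0)) (nhds 1) := by
  have hl := tendsto_log_one_div_nhdsGT_zero
  have hm : Tendsto (fun E : ℝ => Real.log (Real.log (1 / E)))
      (nhdsWithin 0 (Set.Ioi 0)) atTop := Real.tendsto_log_atTop.comp hl
  have hE : ∀ᶠ E : ℝ in nhdsWithin 0 (Set.Ioi 0), E ≤ 1 / 2 :=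
    nhdsWithin_le_nhds (Iic_mem_nhds (by norm_num))
  refine tendsto_of_tendsto_of_tendsto_of_le_of_le'
    ((tendsto_lower_ratio (Real.log lam + 3)).comp hm)
    ((tendsto_upper_ratio (2 + Real.log (1 + 1 / lam))).comp hm) ?_ ?_
  · filter_upwards [hE, self_mem_nhdsWithin, hl.eventually_ge_atTop 2, hm.eventually_ge_atTop 1,
      hm.eventually_ge_atTop (2 / lam),
      hl.eventually (eventually_log_sq_le (by linarith : 0 < lam + 1))] with E hE2 hE0 hl2 hm1 hm2 ha
    rw [Set.mem_Ioi] at hE0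
    simp only [Function.comp_apply]
    set m := Real.log (Real.log (1 / E)) with hm_def
    have ha1 : 1 ≤ Real.log (1 / E) / m ^ 2 := by linarith
    have hrate := onOff_rate_ge hlam hm_def hm1 hl2 (by nlinarith) rfl ha
    have hcap := (C_P_toReal_bounds hlam hE0 hE2 (by linarith) ha1).1
    set a := Real.log (1 / E) / m ^ 2
    have ha0 : 0 < a := by linarith
    have hm0 : 0 < m := by linarith
    rw [div_le_div_iff₀ hm0 (by positivity)]
    have h := (mul_le_mul_of_nonneg_left hrate (by positivity : 0 ≤ E / a)).trans hcap
    rw [← mul_assoc, div_mul_cancel₀ _ ha0.ne'] at h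
    nlinarith [mul_le_mul_of_nonneg_right h hm0.le]
  · filter_upwards [hE, self_mem_nhdsWithin, hl.eventually_ge_atTop 1,
      hm.eventually_ge_atTop (lam + 3)] with E hE2 hE0 hl1 hm1
    rw [Set.mem_Ioi] at hE0
    simp only [Function.comp_apply]
    have hcap := (C_P_toReal_bounds hlam hE0 hE2 hl1 le_rfl).2
    set l := Real.log (1 / E)
    set m := Real.log l with hm_def
    have hm0 : 0 < m := by linarith
    have hc : 0 ≤ Real.log (1 + 1 / lam) :=
      Real.log_nonneg (by have : 0 ≤ 1 / lam := by positivity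
                          linarith)
    have hlog : Real.log (1 + l / lam) ≤ m + Real.log (1 + 1 / lam) := by
      rw [hm_def, ← Real.log_mul (by linarith) (by positivity)]
      refine Real.log_le_log (by positivity) ?_
      have : l * (1 + 1 / lam) = l + l / lam := by ring
      linarith
    have hmax : max (Real.log (1 + l / lam)) (lam + 3) ≤ m + Real.log (1 + 1 / lam) :=
      max_le hlog (by linarith)
    rw [div_le_div_iff₀ (by positivity) hm0]
    have h : (C_P lam E).toReal ≤ (m + (2 + Real.log (1 + 1 / lam))) * E :=
      hcap.trans (by
        have := mul_le_mul_of_nonneg_right hmax hE0.le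
        linarith)
    nlinarith [mul_le_mul_of_nonneg_right h hm0.le]
end

section
/- Fix a dark current λ > 0 and let C_P(E) denote the capacity of the average-intensity-constrained Poisson optical intensity channel with dark current λ. Then limsup_{E → 0⁺} C_P(E) / (E · log log(1/E)) ≤ 1. -/
open MeasureTheory ProbabilityTheory Filter
open scoped Classical

/-- Replacing the output marginal by any other output law can only increase the divergence. -/
theorem klDiv_prod_marginals_le {α β : Type*} [MeasurableSpace α] [MeasurableSpace β]
    [StandardBorelSpace α] [Nonempty α] (J : Measure (α × β)) [IsProbabilityMeasure J]
    (Q : Measure β) [IsProbabilityMeasure Q] :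
    InformationTheory.klDiv J (J.fst.prod J.snd) ≤ InformationTheory.klDiv J (J.fst.prod Q) := by
  set K := J.map Prod.swap with hK
  have : IsProbabilityMeasure K := Measure.isProbabilityMeasure_map measurable_swap.aemeasurable
  have hKJ : K.map Prod.swap = J := by
    rw [hK, Measure.map_map measurable_swap measurable_swap]; simp
  have hfst : K.fst = J.snd := by simp [hK]
  have hcond : J.snd ⊗ₘ K.condKernel = K := by rw [← hfst]; exact K.disintegrate K.condKernel
  calc InformationTheory.klDiv J (J.fst.prod J.snd)
      = InformationTheory.klDiv (K.map Prod.swap) ((J.snd.prod J.fst).map Prod.swap) := by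
        rw [hKJ, Measure.prod_swap]
    _ ≤ InformationTheory.klDiv K (J.snd.prod J.fst) :=
        InformationTheory.klDiv_map_le _ _ measurable_swap
    _ ≤ InformationTheory.klDiv K (Q.prod J.fst) := by
        rw [← Measure.compProd_const, ← Measure.compProd_const, ← hcond,
          InformationTheory.klDiv_compProd_eq_add J.snd Q]
        exact le_add_self
    _ = InformationTheory.klDiv (J.map Prod.swap) ((J.fst.prod Q).map Prod.swap) := by
        rw [Measure.prod_swap]
    _ ≤ InformationTheory.klDiv J (J.fst.prod Q) :=
        InformationTheory.klDiv_map_le _ _ measurable_swap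

/-- The measure on `ℕ` with mass function `q`. -/
noncomputable def natMeasure (q : ℕ → ℝ) : Measure ℕ :=
  Measure.sum fun n => ENNReal.ofReal (q n) • Measure.dirac n

theorem lintegral_natMeasure (q : ℕ → ℝ) (f : ℕ → ENNReal) :
    ∫⁻ n, f n ∂natMeasure q = ∑' n, ENNReal.ofReal (q n) * f n := by
  simp [natMeasure, lintegral_sum_measure, lintegral_dirac]

theorem klDiv_compProd_natMeasure {α : Type*} [MeasurableSpace α] (μ : Measure α)
    [IsProbabilityMeasure μ] (κ : Kernel α ℕ) [IsMarkovKernel κ] (p : α → ℕ → ℝ)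
    (hκ : ∀ x, κ x = natMeasure (p x)) (hp : ∀ n, Measurable fun x => p x n)
    (hp0 : ∀ x n, 0 ≤ p x n) (q : ℕ → ℝ) (hq0 : ∀ n, 0 < q n)
    [IsProbabilityMeasure (natMeasure q)] :
    InformationTheory.klDiv (μ ⊗ₘ κ) (μ.prod (natMeasure q)) =
      ∫⁻ x, ∑' n, ENNReal.ofReal (q n * InformationTheory.klFun (p x n / q n)) ∂μ := by
  set g : α × ℕ → ENNReal := fun z => ENNReal.ofReal (p z.1 z.2 / q z.2) with hg
  have hgm : Measurable g := by
    refine measurable_from_prod_countable_left fun n => ?_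
    exact ((hp n).div_const (q n)).ennreal_ofReal
  have hdens : μ ⊗ₘ κ = (μ.prod (natMeasure q)).withDensity g := by
    refine Measure.ext_of_lintegral _ fun f hf => ?_
    rw [Measure.lintegral_compProd hf, lintegral_withDensity_eq_lintegral_mul _ hgm hf,
      lintegral_prod _ (hgm.mul hf).aemeasurable]
    refine lintegral_congr fun x => ?_
    rw [hκ, lintegral_natMeasure, lintegral_natMeasure]
    refine tsum_congr fun n => ?_
    rw [Pi.mul_apply, ← mul_assoc, hg, ← ENNReal.ofReal_mul (hq0 n).le,
      mul_div_cancel₀ _ (hq0 n).ne']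
  have hac : μ ⊗ₘ κ ≪ μ.prod (natMeasure q) := hdens ▸ withDensity_absolutelyContinuous _ _
  rw [InformationTheory.klDiv_eq_lintegral_klFun_of_ac hac]
  have hrn := Measure.rnDeriv_withDensity (μ.prod (natMeasure q)) hgm
  rw [← hdens] at hrn
  have hm : Measurable fun z => ENNReal.ofReal (InformationTheory.klFun (g z).toReal) := by fun_prop
  have hcongr : (fun z => ENNReal.ofReal (InformationTheory.klFun
      ((μ ⊗ₘ κ).rnDeriv (μ.prod (natMeasure q)) z).toReal)) =ᵐ[μ.prod (natMeasure q)]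
      fun z => ENNReal.ofReal (InformationTheory.klFun (g z).toReal) :=
    hrn.mono fun z hz => by simp only [hz]
  rw [lintegral_congr_ae hcongr, lintegral_prod _ hm.aemeasurable]
  refine lintegral_congr fun x => ?_
  rw [lintegral_natMeasure]
  refine tsum_congr fun n => ?_
  rw [ENNReal.ofReal_mul (hq0 n).le, hg, ENNReal.toReal_ofReal (div_nonneg (hp0 x n) (hq0 n).le)]

theorem tsum_klFun_le {p q : ℕ → ℝ} {r a b : ℝ} (hp0 : ∀ n, 0 < p n) (hq0 : ∀ n, 0 < q n)
    (hp : HasSum p 1) (hq : HasSum q 1) (hpr : HasSum (fun n => p n * n) r)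
    (hlog : ∀ n, Real.log (p n / q n) ≤ a + b * n) :
    ∑' n, ENNReal.ofReal (q n * InformationTheory.klFun (p n / q n)) ≤
      ENNReal.ofReal (a + b * r) := by
  have hle n : q n * InformationTheory.klFun (p n / q n) ≤
      p n * a + p n * n * b + (q n - p n) := by
    have h1 : q n * InformationTheory.klFun (p n / q n)
        = p n * Real.log (p n / q n) + (q n - p n) := by
      have := (hq0 n).ne'
      rw [InformationTheory.klFun]
      field_simp
      ring
    rw [h1]
    nlinarith [mul_le_mul_of_nonneg_left (hlog n) (hp0 n).le]
  have hsum : HasSum (fun n => p n * a + p n * n * b + (q n - p n)) (a + b * r) := by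
    have h := ((hp.mul_right a).add (hpr.mul_right b)).add (hq.sub hp)
    rwa [show 1 * a + r * b + (1 - 1) = a + b * r by ring] at h
  have h0 n : 0 ≤ p n * a + p n * n * b + (q n - p n) :=
    (mul_nonneg (hq0 n).le
      (InformationTheory.klFun_nonneg (div_nonneg (hp0 n).le (hq0 n).le))).trans (hle n)
  rw [← hsum.tsum_eq, ENNReal.ofReal_tsum_of_nonneg h0 hsum.summable]
  exact ENNReal.tsum_le_tsum fun n => ENNReal.ofReal_le_ofReal (hle n)

/-- The Poisson probability mass function with real parameter. -/
noncomputable def poissonMass (r : ℝ) (n : ℕ) : ℝ := Real.exp (-r) * r ^ n / n.factorial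

theorem poissonMass_pos {r : ℝ} (hr : 0 < r) (n : ℕ) : 0 < poissonMass r n := by
  unfold poissonMass
  positivity

theorem hasSum_poissonMass {r : ℝ} (hr : 0 ≤ r) : HasSum (poissonMass r) 1 :=
  hasSum_one_poissonMeasure ⟨r, hr⟩

theorem hasSum_poissonMass_mul_id (r : ℝ) :
    HasSum (fun n : ℕ => poissonMass r n * n) r := by
  have h := (NormedSpace.expSeries_div_hasSum_exp r).mul_left (Real.exp (-r) * r)
  rw [← Real.exp_eq_exp_ℝ, mul_right_comm, ← Real.exp_add, neg_add_cancel, Real.exp_zero,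
    one_mul] at h
  rw [← hasSum_nat_add_iff' 1]
  convert! h using 1
  · ext n
    rw [poissonMass, Nat.factorial_succ]
    push_cast
    have : (n.factorial : ℝ) ≠ 0 := by positivity
    have : (n : ℝ) + 1 ≠ 0 := by positivity
    field_simp
    ring
  · simp

theorem poissonMass_le_one {r : ℝ} (hr : 0 ≤ r) (n : ℕ) : poissonMass r n ≤ 1 :=
  le_hasSum (hasSum_poissonMass hr) n fun m _ => by unfold poissonMass; positivity

theorem log_poissonMass_div {r s : ℝ} (hr : 0 < r) (hs : 0 < s) (n : ℕ) :
    Real.log (poissonMass r n / poissonMass s n) = s - r + n * Real.log (r / s) := by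
  have h : poissonMass r n / poissonMass s n = Real.exp (s - r) * (r / s) ^ n := by
    have : (n.factorial : ℝ) ≠ 0 := by positivity
    rw [poissonMass, poissonMass, sub_eq_add_neg, Real.exp_add, Real.exp_neg s, div_pow]
    field_simp
  rw [h, Real.log_mul (Real.exp_pos _).ne' (by positivity), Real.log_exp, Real.log_pow]

/-- The output law used in the upper bound: the output law at zero input, with a geometric
law mixed in at weight `E`. -/
noncomputable def mixedMass (lam E : ℝ) (n : ℕ) : ℝ :=
  (1 - E) * poissonMass lam n + E * (1 / 2) ^ (n + 1)

section mixedMass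

variable {lam E : ℝ}

theorem mixedMass_pos (hlam : 0 < lam) (hE : 0 < E) (hE1 : E < 1) (n : ℕ) :
    0 < mixedMass lam E n := by
  have := poissonMass_pos hlam n
  have : 0 < 1 - E := by linarith
  unfold mixedMass
  positivity

theorem hasSum_mixedMass (hlam : 0 < lam) : HasSum (mixedMass lam E) 1 := by
  have h := ((hasSum_poissonMass hlam.le).mul_left (1 - E)).add
    ((hasSum_geometric_two' 1).mul_left E)
  convert! h using 1
  · ext n
    rw [mixedMass, pow_succ, one_div_pow]
    ring
  · ring

theorem log_div_mixedMass_le_left (hlam : 0 < lam) (hE : 0 < E) (hE1 : E ≤ 1 / 2) {x : ℝ}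
    (hx : 0 ≤ x) (n : ℕ) :
    Real.log (poissonMass (lam + x) n / mixedMass lam E n) ≤
      (2 * E - x) + Real.log ((lam + x) / lam) * n := by
  have hr : 0 < lam + x := by linarith
  have hp := poissonMass_pos hr n
  have hp0 := poissonMass_pos hlam n
  have hE' : 0 < 1 - E := by linarith
  have hle : (1 - E) * poissonMass lam n ≤ mixedMass lam E n := by
    unfold mixedMass
    linarith [show 0 ≤ E * (1 / 2) ^ (n + 1) by positivity]
  have hlogE : -(2 * E) ≤ Real.log (1 - E) := by
    have h := Real.one_sub_inv_le_log_of_pos hE'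
    have : (1 - E)⁻¹ ≤ 1 + 2 * E := by
      rw [inv_le_iff_one_le_mul₀ hE']
      nlinarith
    linarith
  calc Real.log (poissonMass (lam + x) n / mixedMass lam E n)
      ≤ Real.log (poissonMass (lam + x) n / ((1 - E) * poissonMass lam n)) :=
        Real.log_le_log (div_pos hp (mixedMass_pos hlam hE (by linarith) n)) (by gcongr)
    _ = Real.log (poissonMass (lam + x) n / poissonMass lam n) - Real.log (1 - E) := by
        rw [mul_comm, ← div_div, Real.log_div (div_pos hp hp0).ne' hE'.ne']
    _ ≤ _ := by
        rw [log_poissonMass_div hr hlam]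
        linarith

theorem log_div_mixedMass_le_right (hlam : 0 < lam) (hE : 0 < E) (hE1 : E < 1) {x : ℝ}
    (hx : 0 ≤ x) (n : ℕ) :
    Real.log (poissonMass (lam + x) n / mixedMass lam E n) ≤
      (Real.log (1 / E) + Real.log 2) + Real.log 2 * n := by
  have hr : 0 < lam + x := by linarith
  have hq := mixedMass_pos hlam hE hE1 n
  have hle : E * (1 / 2) ^ (n + 1) ≤ mixedMass lam E n := by
    unfold mixedMass
    have := poissonMass_pos hlam n
    have : 0 ≤ (1 - E) * poissonMass lam n := mul_nonneg (by linarith) this.le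
    linarith
  calc Real.log (poissonMass (lam + x) n / mixedMass lam E n)
      ≤ Real.log (1 / (E * (1 / 2) ^ (n + 1))) :=
        Real.log_le_log (div_pos (poissonMass_pos hr n) hq)
          (div_le_div₀ zero_le_one (poissonMass_le_one hr.le n) (by positivity) hle)
    _ = Real.log (1 / E * 2 ^ (n + 1)) := by
        congr 1
        rw [one_div_pow]
        field_simp
    _ = _ := by
        rw [Real.log_mul (by positivity) (by positivity), Real.log_pow]
        push_cast
        ring

theorem tsum_klFun_poissonMass_le (hlam : 0 < lam) (hE : 0 < E) (hE1 : E ≤ 1 / 2)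
    (hL : 2 ≤ Real.log (1 / E)) (hLL : 2 + 3 / lam ≤ Real.log (Real.log (1 / E))) {x : ℝ}
    (hx : 0 ≤ x) :
    ∑' n, ENNReal.ofReal (mixedMass lam E n *
        InformationTheory.klFun (poissonMass (lam + x) n / mixedMass lam E n)) ≤
      ENNReal.ofReal (x * Real.log (Real.log (1 / E)) + 2 * E) := by
  have hr : 0 < lam + x := by linarith
  have key {a b : ℝ} := tsum_klFun_le (a := a) (b := b) (poissonMass_pos hr)
    (mixedMass_pos hlam hE (by linarith : E < 1)) (hasSum_poissonMass hr.le)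
    (hasSum_mixedMass hlam) (hasSum_poissonMass_mul_id (lam + x))
  set L := Real.log (1 / E)
  rcases le_total ((lam + x) / lam) L with hxL | hxL
  · refine (key (log_div_mixedMass_le_left hlam hE hE1 hx)).trans (ENNReal.ofReal_le_ofReal ?_)
    have hpos : 0 < (lam + x) / lam := by positivity
    have h1 : Real.log ((lam + x) / lam) ≤ Real.log L := Real.log_le_log hpos hxL
    have h2 : lam * Real.log ((lam + x) / lam) ≤ x := by
      calc lam * Real.log ((lam + x) / lam) ≤ lam * ((lam + x) / lam - 1) := by
            gcongr
            exact Real.log_le_sub_one_of_pos hpos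
        _ = x := by field_simp; ring
    nlinarith [mul_le_mul_of_nonneg_left h1 hx]
  · refine (key (log_div_mixedMass_le_right hlam hE (by linarith) hx)).trans
      (ENNReal.ofReal_le_ofReal ?_)
    have hlog2 : Real.log 2 ≤ 1 := by linarith [Real.log_two_lt_d9]
    have hlog20 : 0 ≤ Real.log 2 := Real.log_nonneg one_le_two
    have hdiv : (lam + x) / lam = 1 + x / lam := by field_simp
    rw [hdiv] at hxL
    have h1 : 1 ≤ x / lam := by linarith
    have h2 : lam ≤ x := by rwa [one_le_div hlam] at h1
    have h3 : x * (2 + 3 / lam) ≤ x * Real.log L := by gcongr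
    have h4 : x * (2 + 3 / lam) = 2 * x + 3 * (x / lam) := by ring
    nlinarith [mul_le_mul_of_nonneg_right hlog2 (by linarith : 0 ≤ 1 + (lam + x))]

end mixedMass

/-- The Poisson channel as a Markov kernel. -/
noncomputable def poissonChannel (lam : ℝ) : Kernel ℝ ℕ where
  toFun x := poissonMeasure (Real.toNNReal (lam + x))
  measurable' := by
    refine Measure.measurable_of_measurable_coe _ fun s hs => ?_
    simp only [poissonMeasure, Measure.sum_apply _ hs, Measure.smul_apply, smul_eq_mul]
    fun_prop

instance (lam : ℝ) : IsMarkovKernel (poissonChannel lam) :=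
  ⟨fun x => inferInstanceAs (IsProbabilityMeasure (poissonMeasure (Real.toNNReal (lam + x))))⟩

theorem poissonMI_eq (lam : ℝ) (μ : Measure ℝ) [IsProbabilityMeasure μ] :
    poissonMI lam μ = klDiv (μ ⊗ₘ poissonChannel lam)
      ((μ ⊗ₘ poissonChannel lam).fst.prod (μ ⊗ₘ poissonChannel lam).snd) := by
  have h : μ ⊗ₘ poissonChannel lam = μ.bind fun x =>
      (Measure.dirac x).prod (poissonMeasure (Real.toNNReal (lam + x))) := by
    rw [Measure.compProd_eq_comp_prod]
    congr 1
    ext1 x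
    rw [Kernel.prod_apply, Kernel.id_apply]
    rfl
  rw [poissonMI, h]

theorem klDiv_le_of_klDiv_le {α : Type*} [MeasurableSpace α] {μ ν : Measure α}
    [IsProbabilityMeasure μ] [IsProbabilityMeasure ν] {B : ℝ} (hB : 0 ≤ B)
    (h : InformationTheory.klDiv μ ν ≤ ENNReal.ofReal B) : klDiv μ ν ≤ (B : EReal) := by
  obtain ⟨hac, hint⟩ := InformationTheory.klDiv_ne_top_iff.mp (h.trans_lt ENNReal.ofReal_lt_top).ne
  rw [klDiv, if_pos ⟨hac, hint⟩, EReal.coe_le_coe_iff]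
  rw [InformationTheory.klDiv_of_ac_of_integrable hac hint, ENNReal.ofReal_le_ofReal_iff hB] at h
  simpa [llr] using h

theorem C_P_le {lam E : ℝ} (hlam : 0 < lam) (hE : 0 < E) (hE1 : E ≤ 1 / 2)
    (hL : 2 ≤ Real.log (1 / E)) (hLL : 2 + 3 / lam ≤ Real.log (Real.log (1 / E))) :
    C_P lam E ≤ ((E * Real.log (Real.log (1 / E)) + 2 * E : ℝ) : EReal) := by
  have hLL0 : 0 ≤ Real.log (Real.log (1 / E)) := by
    have : 0 < 3 / lam := by positivity
    linarith
  refine iSup_le fun μ => iSup_le fun _ => iSup_le fun hμ0 => iSup_le fun hμE => ?_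
  rw [poissonMI_eq]
  refine klDiv_le_of_klDiv_le (by positivity) ?_
  have hQ : IsProbabilityMeasure (natMeasure (mixedMass lam E)) :=
    (hasSum_mixedMass hlam).isProbabilityMeasure_sum_dirac
      fun n => (mixedMass_pos hlam hE (by linarith) n).le
  refine (klDiv_prod_marginals_le _ (natMeasure (mixedMass lam E))).trans ?_
  rw [Measure.fst_compProd, klDiv_compProd_natMeasure μ (poissonChannel lam)
    (fun x n => poissonMass (Real.toNNReal (lam + x)) n) (fun _ => rfl)
    (fun n => by unfold poissonMass; fun_prop) (fun x n => by unfold poissonMass; positivity) _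
    (mixedMass_pos hlam hE (by linarith))]
  have hpos : ∀ᵐ x ∂μ, 0 ≤ x := by
    rw [ae_iff]
    simpa [not_le, Set.Iio] using hμ0
  set LL := Real.log (Real.log (1 / E))
  calc _ ≤ ∫⁻ x, ENNReal.ofReal x * ENNReal.ofReal LL + ENNReal.ofReal (2 * E) ∂μ := by
        refine lintegral_mono_ae (hpos.mono fun x hx => ?_)
        simp only [Real.coe_toNNReal _ (by linarith : 0 ≤ lam + x)]
        refine (tsum_klFun_poissonMass_le hlam hE hE1 hL hLL hx).trans_eq ?_
        rw [ENNReal.ofReal_add (by positivity) (by positivity), ENNReal.ofReal_mul hx]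
    _ = (∫⁻ x, ENNReal.ofReal x ∂μ) * ENNReal.ofReal LL + ENNReal.ofReal (2 * E) := by
        rw [lintegral_add_right _ measurable_const, lintegral_mul_const _ (by fun_prop)]
        simp
    _ ≤ ENNReal.ofReal E * ENNReal.ofReal LL + ENNReal.ofReal (2 * E) := by gcongr
    _ = _ := by
        rw [ENNReal.ofReal_add (by positivity) (by positivity), ENNReal.ofReal_mul hE.le]

theorem limsup_le_of_forall_eventually_le {α : Type*} {f : Filter α} {u : α → ℝ} {b : ℝ}
    (hb : 0 ≤ b) (h : ∀ a, b < a → ∀ᶠ x in f, u x ≤ a) : Filter.limsup u f ≤ b := by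
  rw [limsup_eq]
  by_cases hbdd : BddBelow {a | ∀ᶠ x in f, u x ≤ a}
  · exact le_of_forall_gt_imp_ge_of_dense fun a ha => csInf_le hbdd (h a ha)
  · rwa [Real.sInf_of_not_bddBelow hbdd]

theorem poisson_low_snr_capacity_upper {lam : ℝ} (hlam : 0 < lam) :
    Filter.limsup
      (fun E : ℝ => (C_P lam E).toReal / (E * Real.log (Real.log (1 / E))))
      (nhdsWithin 0 (Set.Ioi 0)) ≤ 1 := by
  have hL : Tendsto (fun E : ℝ => Real.log (1 / E)) (nhdsWithin 0 (Set.Ioi 0)) atTop := by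
    simp only [one_div]
    exact Real.tendsto_log_atTop.comp tendsto_inv_nhdsGT_zero
  have hLL := Real.tendsto_log_atTop.comp hL
  refine limsup_le_of_forall_eventually_le zero_le_one fun a ha => ?_
  filter_upwards [self_mem_nhdsWithin, hL.eventually_ge_atTop 2,
    hLL.eventually_ge_atTop (2 + 3 / lam), hLL.eventually_ge_atTop (2 / (a - 1)),
    nhdsWithin_le_nhds (Iic_mem_nhds (by norm_num : (0 : ℝ) < 1 / 2))] with E hE h1 h2 h3 h4
  simp only [Set.mem_Ioi, Set.mem_Iic, Function.comp_apply] at hE h2 h3 h4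
  have hLL0 : 0 < Real.log (Real.log (1 / E)) := by
    have : 0 < 3 / lam := by positivity
    linarith
  have hB : 0 ≤ E * Real.log (Real.log (1 / E)) + 2 * E := by positivity
  rw [div_le_iff₀ (by positivity)]
  calc (C_P lam E).toReal ≤ E * Real.log (Real.log (1 / E)) + 2 * E := by
        have hle := C_P_le hlam hE h4 h1 h2
        by_cases hbot : C_P lam E = ⊥
        · simpa [hbot] using hB
        · exact (EReal.toReal_le_toReal hle hbot (EReal.coe_ne_top _)).trans_eq (EReal.toReal_coe _)
    _ ≤ a * (E * Real.log (Real.log (1 / E))) := by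
        rw [div_le_iff₀ (by linarith)] at h3
        nlinarith
end
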